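/- arXiv:1410.1911 — 2 statements merged into one kernel-verified Lean document; each statement's English description precedes it below -/
import Mathlib

section
/- Let β ∈ (0,2) and fix t > 0 and x ∈ ℝ. Then there exists a constant A > 0 such that for all (t′, x′) with 0 < t′ ≤ t + 1/2 and |x − x′| ≤ 1, for all s ∈ [0, t′) and all y ∈ ℝ with |y| ≥ A, one has G_β(t′ − s, x′ − y) ≤ G_β(t + 1 − s, x − y). -/
open MeasureTheory

/-- The two-parameter Mainardi function `M_{λ,μ}(z) = ∑ (−z)^n / (n! Γ(μ − (n+1)λ))`. -/
noncomputable def mainardiR (lam mu z : ℝ) : ℝ :=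
  ∑' n : ℕ, (-z) ^ n / ((n.factorial : ℝ) * Real.Gamma (mu - ((n : ℝ) + 1) * lam))

/-- The Green function `G_β(t,x) = (t^{⌈β⌉−1−β/2}/2) M_{β/2,⌈β⌉}(|x|/t^{β/2})`. -/
noncomputable def greenG (β t x : ℝ) : ℝ :=
  t ^ ((⌈β⌉₊ : ℝ) - 1 - β / 2) / 2 * mainardiR (β / 2) (⌈β⌉₊ : ℝ) (|x| / t ^ (β / 2))


lemma aux_young (l z : ℝ) (hl0 : 0 < l) (hl1 : l < 1) (hz : 0 ≤ z) :
    ∃ C : ℝ, ∀ r : ℝ, 0 ≤ r → z * r ^ l ≤ r / 2 + C := by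
  refine ⟨(z * 2 ^ l) ^ (1 / (1 - l)), fun r hr => ?_⟩
  set c := (z * 2 ^ l) ^ (1 / (1 - l)) with hc
  have hzl : 0 ≤ z * 2 ^ l := by positivity
  have hc0 : 0 ≤ c := Real.rpow_nonneg hzl _
  have hcl : c ^ (1 - l) = z * 2 ^ l := by
    rw [hc, ← Real.rpow_mul hzl, one_div, inv_mul_cancel₀ (by linarith), Real.rpow_one]
  have h := Real.geom_mean_le_arith_mean2_weighted hl0.le (by linarith : 0 ≤ 1 - l)
    (by linarith : 0 ≤ r / 2) hc0 (by ring)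
  rw [hcl, Real.div_rpow hr (by norm_num)] at h
  have h2 : (0:ℝ) < 2 ^ l := by positivity
  have h3 : r ^ l / 2 ^ l * (z * 2 ^ l) = z * r ^ l := by field_simp
  rw [h3] at h
  nlinarith

lemma aux_bound_integrable (l b z : ℝ) (hl0 : 0 < l) (hl1 : l < 1) (hb : 0 < b) (hz : 0 ≤ z) :
    IntegrableOn (fun r : ℝ => Real.exp (z * r ^ l - r) * r ^ (b - 1)) (Set.Ioi 0) := by
  obtain ⟨C, hC⟩ := aux_young l z hl0 hl1 hz
  have h1 : IntegrableOn (fun r : ℝ => r ^ (b - 1) * Real.exp (-(1 / 2) * r ^ (1:ℝ)))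
      (Set.Ioi 0) :=
    integrableOn_rpow_mul_exp_neg_mul_rpow (by linarith) (by norm_num) (by norm_num)
  refine Integrable.mono' (h1.const_mul (Real.exp C)) ?_ ?_
  · refine ContinuousOn.aestronglyMeasurable ?_ measurableSet_Ioi
    intro r hr
    have hr0 : r ≠ 0 := ne_of_gt hr
    refine ContinuousAt.continuousWithinAt ?_
    have h1 : ContinuousAt (fun r : ℝ => r ^ l) r := Real.continuousAt_rpow_const _ _ (Or.inl hr0)
    have h2 : ContinuousAt (fun r : ℝ => r ^ (b - 1)) r :=
      Real.continuousAt_rpow_const _ _ (Or.inl hr0)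
    exact (((h1.const_mul z).sub continuousAt_id).rexp).mul h2
  · refine (ae_restrict_iff' measurableSet_Ioi).mpr (Filter.Eventually.of_forall fun r hr => ?_)
    have hr0 : 0 < r := hr
    have hp : 0 < r ^ (b - 1) := Real.rpow_pos_of_pos hr0 _
    rw [Real.norm_of_nonneg (by positivity), Real.rpow_one]
    have : Real.exp C * (r ^ (b - 1) * Real.exp (-(1 / 2) * r))
        = Real.exp (C + -(1 / 2) * r) * r ^ (b - 1) := by rw [Real.exp_add]; ring
    rw [this]
    refine mul_le_mul_of_nonneg_right (Real.exp_le_exp.mpr ?_) hp.le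
    have := hC r hr0.le
    linarith

lemma aux_summable (l b z : ℝ) (hl0 : 0 < l) (hl1 : l < 1) (hb : 0 < b) (hz : 0 ≤ z) :
    Summable fun n : ℕ => z ^ n / (n.factorial : ℝ) * Real.Gamma (b + l * n) := by
  have hpos : ∀ n : ℕ, 0 < b + l * n := fun n => by positivity
  have hint : ∀ n : ℕ, IntegrableOn (fun r : ℝ => z ^ n / (n.factorial : ℝ) *
      (Real.exp (-r) * r ^ (b + l * n - 1))) (Set.Ioi 0) := fun n =>
    (Real.GammaIntegral_convergent (hpos n)).const_mul _
  refine summable_of_sum_range_le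
    (c := ∫ r in Set.Ioi (0:ℝ), Real.exp (z * r ^ l - r) * r ^ (b - 1)) ?_ ?_
  · intro n
    have := Real.Gamma_pos_of_pos (hpos n)
    positivity
  · intro N
    have : ∀ n : ℕ, z ^ n / (n.factorial : ℝ) * Real.Gamma (b + l * n) =
        ∫ r in Set.Ioi (0:ℝ), z ^ n / (n.factorial : ℝ) *
      (Real.exp (-r) * r ^ (b + l * n - 1)) := by
      intro n
      rw [Real.Gamma_eq_integral (hpos n), integral_const_mul]
    simp_rw [this]
    rw [← integral_finsetSum _ (fun n _ => hint n)]
    refine setIntegral_mono_on (integrable_finsetSum _ (fun n _ => hint n))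
      (aux_bound_integrable l b z hl0 hl1 hb hz) measurableSet_Ioi ?_
    intro r hr
    have hr0 : 0 < r := hr
    have e : ∀ n : ℕ, z ^ n / (n.factorial : ℝ) * (Real.exp (-r) * r ^ (b + l * n - 1))
        = (z * r ^ l) ^ n / (n.factorial : ℝ) * (Real.exp (-r) * r ^ (b - 1)) := by
      intro n
      rw [show b + l * n - 1 = (b - 1) + l * n by ring, Real.rpow_add hr0, Real.rpow_mul hr0.le,
        Real.rpow_natCast, mul_pow]
      ring
    simp_rw [e]
    rw [← Finset.sum_mul, show z * r ^ l - r = z * r ^ l + -r by ring, Real.exp_add, mul_assoc]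
    refine mul_le_mul_of_nonneg_right ?_ (by positivity)
    exact Real.sum_le_exp_of_nonneg (by positivity) N

lemma aux_reflect (s : ℝ) (hs : 0 < s) :
    Real.sin (Real.pi * s) * Real.Gamma s = Real.pi / Real.Gamma (1 - s) := by
  have h := Real.Gamma_mul_Gamma_one_sub s
  have hg := (Real.Gamma_pos_of_pos hs).ne'
  by_cases h0 : Real.sin (Real.pi * s) = 0
  · rw [h0, div_zero] at h
    have : Real.Gamma (1 - s) = 0 := by simpa [hg] using h
    rw [this, h0]; simp
  · have h1 : Real.Gamma (1 - s) ≠ 0 := by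
      intro h1
      rw [h1, mul_zero] at h
      have := div_ne_zero Real.pi_ne_zero h0
      exact this h.symm
    rw [eq_div_iff h0] at h
    rw [eq_div_iff h1]
    linarith

/-- The Wright-type series. -/
noncomputable def wrightS (l b z : ℝ) : ℝ :=
  ∑' n : ℕ, (-z) ^ n / ((n.factorial : ℝ) * Real.Gamma (1 - (b + l * n)))

lemma aux_integral (l b z : ℝ) (hl0 : 0 < l) (hl1 : l < 1) (hb : 0 < b) (hz : 0 ≤ z)
    (h : ℝ → ℝ) (hh : ∀ r, 0 < r → h r = (Complex.exp (-r - z * (r ^ l : ℝ) *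
      Complex.exp (l * Real.pi * Complex.I) + b * Real.pi * Complex.I)).im * r ^ (b - 1)) :
    IntegrableOn h (Set.Ioi 0) ∧ ∫ r in Set.Ioi (0:ℝ), h r = Real.pi * wrightS l b z := by
  have hpos : ∀ n : ℕ, 0 < b + l * n := fun n => by positivity
  let F : ℕ → ℝ → ℝ := fun n r => (-z) ^ n / (n.factorial : ℝ) *
    Real.sin (Real.pi * (b + l * n)) * (Real.exp (-r) * r ^ (b + l * n - 1))
  have hint : ∀ n : ℕ, IntegrableOn (F n) (Set.Ioi 0) := fun n =>
    (Real.GammaIntegral_convergent (hpos n)).const_mul _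
  have hsum : ∀ r, 0 < r → HasSum (fun n => F n r) (h r) := by
    intro r hr
    rw [hh r hr]
    have h1 := NormedSpace.expSeries_div_hasSum_exp (𝔸 := ℂ)
      (-(z * (r ^ l : ℝ) * Complex.exp (l * Real.pi * Complex.I)))
    rw [← Complex.exp_eq_exp_ℂ] at h1
    have h2 := Complex.hasSum_im (h1.mul_left (Complex.exp (-r + b * Real.pi * Complex.I)))
    rw [← Complex.exp_add] at h2
    have h3 := h2.mul_right (r ^ (b - 1))
    have e1 : (-r + b * Real.pi * Complex.I +
        -(z * (r ^ l : ℝ) * Complex.exp (l * Real.pi * Complex.I)) : ℂ)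
      = -r - z * (r ^ l : ℝ) * Complex.exp (l * Real.pi * Complex.I) + b * Real.pi * Complex.I := by
      ring
    rw [e1] at h3
    convert! h3 using 2 with n
    have e2 : Complex.exp (-r + b * Real.pi * Complex.I) *
        ((-(z * (r ^ l : ℝ) * Complex.exp (l * Real.pi * Complex.I))) ^ n / (n.factorial : ℂ))
        = ((Real.exp (-r) * ((-z) ^ n * (r ^ l) ^ n / n.factorial) : ℝ) : ℂ) *
          Complex.exp ((Real.pi * (b + l * n) : ℝ) * Complex.I) := by
      have : ((Real.pi * (b + l * n) : ℝ) * Complex.I : ℂ) = b * Real.pi * Complex.I +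
        n * (l * Real.pi * Complex.I) := by push_cast; ring
      rw [this, Complex.exp_add, Complex.exp_add, Complex.exp_nat_mul, neg_mul_eq_neg_mul,
        mul_pow, neg_mul_eq_neg_mul, mul_pow]
      push_cast
      ring
    rw [e2, Complex.im_ofReal_mul, Complex.exp_ofReal_mul_I_im]
    simp only [F]
    rw [show b + l * n - 1 = (b - 1) + l * n by ring, Real.rpow_add hr, Real.rpow_mul hr.le,
        Real.rpow_natCast]
    ring
  have hae : ∀ᵐ r ∂(volume.restrict (Set.Ioi (0:ℝ))), (∑' n, F n r) = h r :=
    (ae_restrict_iff' measurableSet_Ioi).mpr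
      (Filter.Eventually.of_forall fun r hr => (hsum r hr).tsum_eq)
  have hval : ∀ n, ∫ r in Set.Ioi (0:ℝ), F n r =
      Real.pi * ((-z) ^ n / ((n.factorial : ℝ) * Real.Gamma (1 - (b + l * n)))) := by
    intro n
    simp only [F]
    rw [integral_const_mul, ← Real.Gamma_eq_integral (hpos n), mul_assoc, aux_reflect _ (hpos n)]
    rw [div_mul_div_comm, mul_div_assoc']
    ring
  have hS : Summable fun n => ∫ r in Set.Ioi (0:ℝ), ‖F n r‖ := by
    refine Summable.of_nonneg_of_le (fun n => integral_nonneg fun r => norm_nonneg _) ?_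
      (aux_summable l b z hl0 hl1 hb hz)
    intro n
    rw [Real.Gamma_eq_integral (hpos n), ← integral_const_mul]
    refine setIntegral_mono_on (hint n).norm
      ((Real.GammaIntegral_convergent (hpos n)).const_mul _) measurableSet_Ioi ?_
    intro r hr
    have hr0 : 0 < r := hr
    simp only [F]
    rw [norm_mul, norm_mul, norm_div, norm_pow, norm_neg, Real.norm_of_nonneg hz,
      Real.norm_of_nonneg (by positivity : (0:ℝ) ≤ n.factorial),
      Real.norm_of_nonneg (by positivity : 0 ≤ Real.exp (-r) * r ^ (b + l * n - 1))]
    refine mul_le_mul_of_nonneg_right ?_ (by positivity)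
    exact mul_le_of_le_one_right (by positivity) (Real.abs_sin_le_one _)
  have hmain := hasSum_integral_of_summable_integral_norm hint hS
  rw [integral_congr_ae hae] at hmain
  simp_rw [hval] at hmain
  refine ⟨?_, ?_⟩
  · refine Integrable.mono' (aux_bound_integrable l b z hl0 hl1 hb hz) ?_ ?_
    · refine AEStronglyMeasurable.congr (f := fun r : ℝ => (Complex.exp (-r - z * (r ^ l : ℝ) *
      Complex.exp (l * Real.pi * Complex.I) + b * Real.pi * Complex.I)).im * r ^ (b - 1)) ?_
        ((ae_restrict_iff' measurableSet_Ioi).mpr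
          (Filter.Eventually.of_forall fun r hr => (hh r hr).symm))
      refine ContinuousOn.aestronglyMeasurable ?_ measurableSet_Ioi
      intro r hr
      have hr0 : r ≠ 0 := ne_of_gt hr
      refine ContinuousAt.continuousWithinAt ?_
      have h1 : ContinuousAt (fun r : ℝ => r ^ l) r :=
        Real.continuousAt_rpow_const _ _ (Or.inl hr0)
      have h2 : ContinuousAt (fun r : ℝ => r ^ (b - 1)) r :=
        Real.continuousAt_rpow_const _ _ (Or.inl hr0)
      refine ContinuousAt.mul ?_ h2
      refine Complex.continuous_im.continuousAt.comp ?_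
      refine ContinuousAt.cexp ?_
      refine ContinuousAt.add ?_ continuousAt_const
      refine ContinuousAt.sub Complex.continuous_ofReal.continuousAt.neg ?_
      refine ContinuousAt.mul ?_ continuousAt_const
      exact continuousAt_const.mul (Complex.continuous_ofReal.continuousAt.comp h1)
    · refine (ae_restrict_iff' measurableSet_Ioi).mpr (Filter.Eventually.of_forall fun r hr => ?_)
      have hr0 : 0 < r := hr
      have hp : 0 < r ^ (b - 1) := Real.rpow_pos_of_pos hr0 _
      rw [hh r hr, norm_mul, Real.norm_of_nonneg hp.le]
      refine mul_le_mul_of_nonneg_right ?_ hp.le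
      refine (Complex.abs_im_le_norm _).trans ?_
      rw [Complex.norm_exp]
      refine Real.exp_le_exp.mpr ?_
      have e1 : (Complex.exp (l * Real.pi * Complex.I)) =
          Complex.exp ((l * Real.pi : ℝ) * Complex.I) := by push_cast; rfl
      have e2 : (-r - z * (r ^ l : ℝ) * Complex.exp (l * Real.pi * Complex.I)
          + b * Real.pi * Complex.I : ℂ).re = -r - z * r ^ l * Real.cos (l * Real.pi) := by
        rw [e1, ← Complex.ofReal_mul, Complex.add_re, Complex.sub_re, Complex.re_ofReal_mul,
          Complex.exp_ofReal_mul_I_re]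
        simp
      rw [e2]
      have h1 := Real.neg_one_le_cos (l * Real.pi)
      have h2 : 0 ≤ z * r ^ l := by positivity
      nlinarith
  · rw [← hmain.tsum_eq, tsum_mul_left]; rfl

/-- Integrand of the Hankel integral in logarithmic coordinates. -/
noncomputable def hankelH (l b z : ℝ) (v : ℂ) : ℂ :=
  Complex.exp (Complex.exp v - z * Complex.exp (l * v) + b * v)

lemma hankelH_eq (l b z u θ : ℝ) : hankelH l b z (u + θ * Complex.I) =
    Complex.exp (((Real.exp u * Real.cos θ - z * Real.exp (l * u) * Real.cos (l * θ) + b * u : ℝ) : ℂ)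
      + ((Real.exp u * Real.sin θ - z * Real.exp (l * u) * Real.sin (l * θ) + b * θ : ℝ) : ℂ)
        * Complex.I) := by
  unfold hankelH
  congr 1
  have e1 : (l * (u + θ * Complex.I) : ℂ) = (l * u : ℝ) + (l * θ : ℝ) * Complex.I := by
    push_cast; ring
  rw [e1, Complex.exp_add, Complex.exp_add, Complex.exp_mul_I, Complex.exp_mul_I]
  push_cast
  ring

lemma hankelH_norm (l b z u θ : ℝ) : ‖hankelH l b z (u + θ * Complex.I)‖ =
    Real.exp (Real.exp u * Real.cos θ - z * Real.exp (l * u) * Real.cos (l * θ) + b * u) := by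
  rw [hankelH_eq, Complex.norm_exp]
  congr 1
  simp only [Complex.add_re, Complex.ofReal_re, Complex.mul_re, Complex.I_re, Complex.I_im,
    Complex.ofReal_im]
  ring

lemma exists_prim (l b z : ℝ) : ∃ Φ : ℂ → ℂ, (∀ v, HasDerivAt Φ (hankelH l b z v) v) ∧
    ∀ u : ℝ, (Φ u).im = 0 := by
  have hd : Differentiable ℂ (hankelH l b z) := by
    unfold hankelH; fun_prop
  obtain ⟨Φ, h0, hΦ⟩ := (hd.isExactOn_univ).with_val_at 0 0
  refine ⟨Φ, fun v => hΦ v (Set.mem_univ _), ?_⟩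
  have hder : ∀ u : ℝ, HasDerivAt (fun u : ℝ => (Φ u).im) 0 u := by
    intro u
    have h1 := (hΦ (u : ℂ) (Set.mem_univ _)).comp_ofReal
    have h2 := (Complex.imCLM.hasFDerivAt.comp_hasDerivAt u h1)
    have h3 : Complex.imCLM (hankelH l b z u) = 0 := by
      have := hankelH_eq l b z u 0
      simp only [Complex.ofReal_zero, zero_mul, add_zero, Real.sin_zero, mul_zero, sub_zero] at this
      rw [this, ← Complex.ofReal_exp, Complex.imCLM_apply, Complex.ofReal_im]
    rw [h3] at h2
    exact h2
  intro u
  have := is_const_of_deriv_eq_zero (fun x => (hder x).differentiableAt) (fun x => (hder x).deriv)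
    u 0
  rw [this]
  simp [h0]

lemma prim_vertical {l b z : ℝ} {Φ : ℂ → ℂ} (hΦ : ∀ v, HasDerivAt Φ (hankelH l b z v) v)
    (u t1 t2 C : ℝ) (h12 : t1 ≤ t2)
    (hC : ∀ t ∈ Set.Icc t1 t2, ‖hankelH l b z (u + t * Complex.I)‖ ≤ C) :
    |(Φ (u + t2 * Complex.I)).im - (Φ (u + t1 * Complex.I)).im| ≤ C * (t2 - t1) := by
  have h := norm_image_sub_le_of_norm_deriv_le_segment' (f := fun t : ℝ => Φ (u + t * Complex.I))
    (f' := fun t : ℝ => hankelH l b z (u + t * Complex.I) * Complex.I) (a := t1) (b := t2) (C := C)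
    ?_ ?_ t2 ⟨h12, le_rfl⟩
  · refine le_trans ?_ h
    rw [← Complex.sub_im]
    exact Complex.abs_im_le_norm _
  · intro t _
    have h1 : HasDerivAt (fun t : ℝ => (u + t * Complex.I : ℂ)) Complex.I t := by
      simpa using ((Complex.ofRealCLM.hasDerivAt (x := t)).mul_const Complex.I).const_add (u : ℂ)
    exact ((hΦ _).comp t h1).hasDerivWithinAt
  · intro t ht
    rw [norm_mul, Complex.norm_I, mul_one]
    exact hC t ⟨ht.1, ht.2.le⟩

lemma prim_ray {l b z : ℝ} (hl0 : 0 < l) (hl1 : l < 1) (hb : 0 < b) (hz : 0 ≤ z)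
    {Φ : ℂ → ℂ} (hΦ : ∀ v, HasDerivAt Φ (hankelH l b z v) v) (hre : ∀ u : ℝ, (Φ u).im = 0) :
    Filter.Tendsto (fun U : ℝ => (Φ (U + Real.pi * Complex.I)).im) Filter.atTop
      (nhds (Real.pi * wrightS l b z)) := by
  -- behaviour at minus infinity
  have hbot : Filter.Tendsto (fun U : ℝ => (Φ (U + Real.pi * Complex.I)).im) Filter.atBot
      (nhds 0) := by
    have hb1 : ∀ᶠ U : ℝ in Filter.atBot, ‖(Φ (U + Real.pi * Complex.I)).im‖ ≤
        Real.exp (1 + z) * Real.pi * Real.exp (b * U) := by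
      filter_upwards [Filter.eventually_le_atBot (0:ℝ)] with U hU
      have h := prim_vertical hΦ U 0 Real.pi (Real.exp (1 + z + b * U)) Real.pi_pos.le ?_
      · simp only [Complex.ofReal_zero, zero_mul, add_zero, hre, sub_zero] at h
        rw [Real.exp_add] at h
        rw [Real.norm_eq_abs]
        linarith
      · intro t _
        rw [hankelH_norm]
        refine Real.exp_le_exp.mpr ?_
        have h1 : Real.exp U ≤ 1 := Real.exp_le_one_iff.mpr hU
        have h2 : Real.exp (l * U) ≤ 1 := Real.exp_le_one_iff.mpr (by nlinarith)
        have h3 := Real.cos_le_one t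
        have h4 := Real.neg_one_le_cos (l * t)
        have h5 := Real.exp_pos U
        have h6 := Real.exp_pos (l * U)
        have h7 : Real.exp U * Real.cos t ≤ 1 := by nlinarith
        have h8 : -(z * Real.exp (l * U) * Real.cos (l * t)) ≤ z := by
          have : z * Real.exp (l * U) ≤ z := mul_le_of_le_one_right hz h2
          have h9 : 0 ≤ z * Real.exp (l * U) := by positivity
          nlinarith
        linarith
    refine squeeze_zero_norm' hb1 ?_
    have : Filter.Tendsto (fun U : ℝ => b * U) Filter.atBot Filter.atBot :=
      Filter.tendsto_id.const_mul_atBot hb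
    simpa using (Real.tendsto_exp_atBot.comp this).const_mul (Real.exp (1 + z) * Real.pi)
  have hlog : ∀ r : ℝ, 0 < r → HasDerivAt (fun r : ℝ => (Φ (Real.log r + Real.pi * Complex.I)).im)
      ((hankelH l b z (Real.log r + Real.pi * Complex.I)).im * r⁻¹) r := by
    intro r hr
    have h1 : HasDerivAt (fun t : ℝ => (Real.log t + Real.pi * Complex.I : ℂ)) ((r⁻¹ : ℝ) : ℂ) r :=
      (Real.hasDerivAt_log hr.ne').ofReal_comp.add_const _
    have h2 := (Complex.imCLM.hasFDerivAt.comp_hasDerivAt r ((hΦ _).comp r h1))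
    convert! h2 using 1
    simp only [Complex.imCLM_apply]
    rw [mul_comm, mul_comm _ ((r⁻¹ : ℝ) : ℂ), Complex.im_ofReal_mul]
  obtain ⟨hI, hV⟩ := aux_integral l b z hl0 hl1 hb hz
    (fun r => (hankelH l b z (Real.log r + Real.pi * Complex.I)).im * r⁻¹) (by
      intro r hr
      have e1 : hankelH l b z (Real.log r + Real.pi * Complex.I) =
          ((r ^ b : ℝ) : ℂ) * Complex.exp (-r - z * (r ^ l : ℝ) *
      Complex.exp (l * Real.pi * Complex.I) + b * Real.pi * Complex.I) := by
        have hrb : ((r ^ b : ℝ) : ℂ) = Complex.exp (Real.log r * b) := by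
          rw [Real.rpow_def_of_pos hr]; push_cast; rfl
        have hrl : ((r ^ l : ℝ) : ℂ) = Complex.exp (Real.log r * l) := by
          rw [Real.rpow_def_of_pos hr]; push_cast; rfl
        rw [hrb, hrl, ← Complex.exp_add, hankelH]
        congr 1
        rw [Complex.exp_add, Complex.exp_pi_mul_I, ← Complex.ofReal_exp, Real.exp_log hr,
          mul_add, Complex.exp_add]
        ring_nf
      rw [e1, Complex.im_ofReal_mul, Real.rpow_sub_one hr.ne']
      ring)
  let f : ℝ → ℝ := fun r => if 0 < r then (Φ (Real.log r + Real.pi * Complex.I)).im else 0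
  have hfd : ∀ r ∈ Set.Ioi (0:ℝ), HasDerivAt f
      ((hankelH l b z (Real.log r + Real.pi * Complex.I)).im * r⁻¹) r := by
    intro r hr
    refine (hlog r hr).congr_of_eventuallyEq ?_
    filter_upwards [Ioi_mem_nhds (show (0:ℝ) < r from hr)] with s hs
    exact if_pos hs
  have hlim := tendsto_limUnder_of_hasDerivAt_of_integrableOn_Ioi hfd hI
  have hf0 : f 0 = 0 := if_neg (lt_irrefl _)
  have hcont : ContinuousWithinAt f (Set.Ici 0) 0 := by
    rw [← continuousWithinAt_Ioi_iff_Ici, ContinuousWithinAt, hf0]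
    refine Filter.Tendsto.congr' ?_ (hbot.comp Real.tendsto_log_nhdsGT_zero)
    filter_upwards [self_mem_nhdsWithin] with r hr
    exact (if_pos hr).symm
  have hint := integral_Ioi_of_hasDerivAt_of_tendsto hcont hfd hI hlim
  rw [hV, hf0, sub_zero] at hint
  rw [← hint] at hlim
  refine Filter.Tendsto.congr ?_ (hlim.comp Real.tendsto_exp_atTop)
  intro U
  simp [f, Real.exp_pos]

/-- Logarithm of the radius along the steepest descent curve. -/
noncomputable def curveL (l θ : ℝ) : ℝ :=
  (Real.log (Real.sin (l * θ)) - Real.log (Real.sin θ)) / (1 - l)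

noncomputable def curveK (l θ : ℝ) : ℝ :=
  Real.exp (l * curveL l θ) * (Real.sin ((1 - l) * θ) / Real.sin θ)

noncomputable def curveW (l b θ : ℝ) : ℝ :=
  Real.exp (b * curveL l θ) *
    ((l * (Real.cos (l * θ) / Real.sin (l * θ)) - Real.cos θ / Real.sin θ) / (1 - l)
      * Real.sin (b * θ) + Real.cos (b * θ))

lemma sin_scale (l θ : ℝ) (hl0 : 0 ≤ l) (hl1 : l ≤ 1) (h0 : 0 < θ) (hp : θ < Real.pi) :
    l * Real.sin θ ≤ Real.sin (l * θ) := by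
  have h := strictConcaveOn_sin_Icc.concaveOn.2 (x := 0) ⟨le_rfl, Real.pi_pos.le⟩ (y := θ)
    ⟨h0.le, hp.le⟩ (by linarith : 0 ≤ 1 - l) hl0 (by ring)
  simpa using h

lemma sin_pos_scale (l θ : ℝ) (hl0 : 0 < l) (hl1 : l ≤ 1) (h0 : 0 < θ) (hp : θ < Real.pi) :
    0 < Real.sin (l * θ) :=
  Real.sin_pos_of_pos_of_lt_pi (by positivity) (by nlinarith)

lemma curveW_nonneg (l b θ : ℝ) (hl0 : 0 < l) (hl1 : l < 1) (hb : 0 < b) (hb1 : b ≤ 1)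
    (h0 : 0 < θ) (hp : θ < Real.pi) : 0 ≤ curveW l b θ := by
  unfold curveW
  refine mul_nonneg (Real.exp_pos _).le ?_
  have h1 := sin_pos_scale l θ hl0 hl1.le h0 hp
  have h2 := Real.sin_pos_of_pos_of_lt_pi h0 hp
  have h3 := sin_pos_scale b θ hb hb1 h0 hp
  have h4 := sin_pos_scale (1 - l) θ (by linarith) (by linarith) h0 hp
  have h5 : 0 ≤ Real.sin ((1 - b) * θ) :=
    Real.sin_nonneg_of_nonneg_of_le_pi (mul_nonneg (by linarith) h0.le) (by nlinarith)
  have hl : 0 < 1 - l := by linarith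
  have e4 : Real.sin ((1 - l) * θ) = Real.sin θ * Real.cos (l * θ) - Real.cos θ * Real.sin (l * θ) := by
    rw [← Real.sin_sub]; ring_nf
  have e5 : Real.sin ((1 - b) * θ) = Real.sin θ * Real.cos (b * θ) - Real.cos θ * Real.sin (b * θ) := by
    rw [← Real.sin_sub]; ring_nf
  have key : (l * (Real.cos (l * θ) / Real.sin (l * θ)) - Real.cos θ / Real.sin θ) / (1 - l)
      * Real.sin (b * θ) + Real.cos (b * θ) =
      ((1 - l) * Real.sin (l * θ) * Real.sin ((1 - b) * θ) +
        l * Real.sin (b * θ) * Real.sin ((1 - l) * θ)) /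
        ((1 - l) * Real.sin (l * θ) * Real.sin θ) := by
    rw [e4, e5, eq_div_iff (by positivity)]
    have h1' := h1.ne'
    have h2' := h2.ne'
    have hl' := hl.ne'
    generalize Real.sin (l * θ) = p at *
    generalize Real.sin θ = q at *
    generalize Real.cos (l * θ) = p' at *
    generalize Real.cos θ = q' at *
    field_simp
    ring
  rw [key]
  positivity

lemma curveK_lower (l : ℝ) (hl0 : 0 < l) (hl1 : l < 1) : ∃ K0 > 0, ∀ θ, 0 < θ → θ < Real.pi →
    K0 ≤ curveK l θ := by
  have hl : 0 < 1 - l := by linarith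
  refine ⟨Real.exp (l * (Real.log l / (1 - l))) * (1 - l), by positivity, fun θ h0 hp => ?_⟩
  have h2 := Real.sin_pos_of_pos_of_lt_pi h0 hp
  unfold curveK
  refine mul_le_mul (Real.exp_le_exp.mpr ?_) ?_ hl.le (Real.exp_pos _).le
  · refine mul_le_mul_of_nonneg_left ?_ hl0.le
    unfold curveL
    refine div_le_div_of_nonneg_right ?_ hl.le
    have := Real.log_le_log (by positivity) (sin_scale l θ hl0.le hl1.le h0 hp)
    rw [Real.log_mul hl0.ne' h2.ne'] at this
    linarith
  · rw [le_div_iff₀ h2]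
    exact sin_scale (1 - l) θ hl.le (by linarith) h0 hp

lemma curveL_exp (l c θ : ℝ) (hl0 : 0 < l) (hl1 : l < 1) (h0 : 0 < θ) (hp : θ < Real.pi) :
    Real.exp (c + curveL l θ) = Real.exp c * Real.exp (l * curveL l θ) *
      (Real.sin (l * θ) / Real.sin θ) := by
  have h1 := sin_pos_scale l θ hl0 hl1.le h0 hp
  have h2 := Real.sin_pos_of_pos_of_lt_pi h0 hp
  have : Real.sin (l * θ) / Real.sin θ = Real.exp ((1 - l) * curveL l θ) := by
    have hl : (1 - l) ≠ 0 := by linarith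
    unfold curveL
    rw [mul_div_cancel₀ _ hl, Real.exp_sub, Real.exp_log h1, Real.exp_log h2]
  rw [this, ← Real.exp_add, ← Real.exp_add]
  ring_nf

lemma hankelH_curve (l b c θ : ℝ) (hl0 : 0 < l) (hl1 : l < 1) (h0 : 0 < θ) (hp : θ < Real.pi) :
    hankelH l b (Real.exp ((1 - l) * c)) ((c + curveL l θ : ℝ) + θ * Complex.I) =
    ((Real.exp (b * c) * Real.exp (-Real.exp c * curveK l θ) * Real.exp (b * curveL l θ) : ℝ) : ℂ) *
      Complex.exp ((b * θ : ℝ) * Complex.I) := by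
  have h2 := (Real.sin_pos_of_pos_of_lt_pi h0 hp).ne'
  have e0 : Real.exp ((1 - l) * c) * Real.exp (l * (c + curveL l θ)) =
      Real.exp c * Real.exp (l * curveL l θ) := by
    rw [← Real.exp_add, ← Real.exp_add]; ring_nf
  have e4 : Real.sin ((1 - l) * θ) = Real.sin θ * Real.cos (l * θ) - Real.cos θ * Real.sin (l * θ) := by
    rw [← Real.sin_sub]; ring_nf
  rw [hankelH_eq, Complex.exp_add, e0, curveL_exp l c θ hl0 hl1 h0 hp]
  congr 1
  · have e5 : Real.exp c * Real.exp (l * curveL l θ) * (Real.sin (l * θ) / Real.sin θ) * Real.cos θ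
        - Real.exp c * Real.exp (l * curveL l θ) * Real.cos (l * θ) + b * (c + curveL l θ)
        = b * c + (-Real.exp c * curveK l θ) + b * curveL l θ := by
      unfold curveK
      rw [e4]
      generalize Real.exp c = p
      generalize Real.exp (l * curveL l θ) = q
      field_simp
      ring
    rw [← Complex.ofReal_exp, e5, Real.exp_add, Real.exp_add]
  · congr 3
    field_simp
    ring

lemma curveL_deriv (l θ : ℝ) (hl0 : 0 < l) (hl1 : l < 1) (h0 : 0 < θ) (hp : θ < Real.pi) :
    HasDerivAt (curveL l) ((l * (Real.cos (l * θ) / Real.sin (l * θ)) -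
      Real.cos θ / Real.sin θ) / (1 - l)) θ := by
  have h1 := (sin_pos_scale l θ hl0 hl1.le h0 hp).ne'
  have h2 := (Real.sin_pos_of_pos_of_lt_pi h0 hp).ne'
  have d1 : HasDerivAt (fun θ : ℝ => l * θ) l θ := by
    simpa using (hasDerivAt_id θ).const_mul l
  have d2 := (d1.sin).log h1
  have d3 := (Real.hasDerivAt_sin θ).log h2
  have d4 := (d2.sub d3).div_const (1 - l)
  convert! d4 using 1
  ring

lemma curve_rep (l b c : ℝ) (hl0 : 0 < l) (hl1 : l < 1) (hb : 0 < b) :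
    ∃ N : ℝ → ℝ, (∀ θ, 0 < θ → θ < Real.pi → HasDerivAt N
      (Real.exp (b * c) * Real.exp (-Real.exp c * curveK l θ) * curveW l b θ) θ) ∧
      Filter.Tendsto N (nhdsWithin 0 (Set.Ioi 0)) (nhds 0) ∧
      Filter.Tendsto N (nhdsWithin Real.pi (Set.Iio Real.pi))
        (nhds (Real.pi * wrightS l b (Real.exp ((1 - l) * c)))) := by
  set z := Real.exp ((1 - l) * c) with hzdef
  have hz : 0 ≤ z := (Real.exp_pos _).le
  have hl : 0 < 1 - l := by linarith
  obtain ⟨Φ, hΦ, hre⟩ := exists_prim l b z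
  have hray := prim_ray hl0 hl1 hb hz hΦ hre
  refine ⟨fun θ => (Φ ((c + curveL l θ : ℝ) + θ * Complex.I)).im, ?_, ?_, ?_⟩
  · intro θ h0 hp
    have d1 := curveL_deriv l θ hl0 hl1 h0 hp
    have d2 := (d1.const_add c).ofReal_comp
    have d3 : HasDerivAt (fun t : ℝ => (t * Complex.I : ℂ)) Complex.I θ := by
      simpa using ((Complex.ofRealCLM.hasDerivAt (x := θ)).mul_const Complex.I)
    have d4 := (hΦ _).comp θ (d2.add d3)
    have d5 := (Complex.imCLM.hasFDerivAt.comp_hasDerivAt θ d4)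
    convert! d5 using 1
    simp only [Complex.imCLM_apply, Pi.add_apply]
    rw [hzdef, hankelH_curve l b c θ hl0 hl1 h0 hp, mul_assoc ((_ : ℝ) : ℂ), Complex.im_ofReal_mul]
    rw [Complex.exp_mul_I, ← Complex.ofReal_cos, ← Complex.ofReal_sin]
    simp only [curveW, Complex.mul_im, Complex.add_re, Complex.add_im, Complex.ofReal_re,
      Complex.ofReal_im, Complex.I_re, Complex.I_im, Complex.mul_re]
    ring
  · have hb1 : ∀ᶠ θ : ℝ in nhdsWithin 0 (Set.Ioi 0),
        ‖(Φ ((c + curveL l θ : ℝ) + θ * Complex.I)).im‖ ≤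
        Real.exp (Real.exp c + z * Real.exp (l * c) + b * c) * θ := by
      have hm : Set.Ioo (0:ℝ) (Real.pi / 2) ∈ nhdsWithin (0:ℝ) (Set.Ioi 0) :=
        Ioo_mem_nhdsGT (by positivity)
      filter_upwards [hm] with θ hθ
      have hp : θ < Real.pi := by linarith [hθ.2, Real.pi_pos]
      have hs := sin_pos_scale l θ hl0 hl1.le hθ.1 hp
      have hL : curveL l θ ≤ 0 := by
        unfold curveL
        refine div_nonpos_of_nonpos_of_nonneg ?_ hl.le
        have h1 : Real.sin (l * θ) ≤ Real.sin θ :=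
          Real.sin_le_sin_of_le_of_le_pi_div_two (by nlinarith [hθ.1, hθ.2, Real.pi_pos])
            hθ.2.le (by nlinarith [hθ.1])
        linarith [Real.log_le_log hs h1]
      have h := prim_vertical hΦ (c + curveL l θ) 0 θ
        (Real.exp (Real.exp c + z * Real.exp (l * c) + b * c)) hθ.1.le ?_
      · simp only [Complex.ofReal_zero, zero_mul, add_zero, hre, sub_zero] at h
        rw [Real.norm_eq_abs]
        exact h
      · intro t _
        rw [hankelH_norm]
        refine Real.exp_le_exp.mpr ?_
        set u := c + curveL l θ with hu
        have huc : u ≤ c := by linarith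
        have h1 : Real.exp u ≤ Real.exp c := Real.exp_le_exp.mpr huc
        have h2 : Real.exp (l * u) ≤ Real.exp (l * c) := Real.exp_le_exp.mpr (by nlinarith)
        have h3 := Real.cos_le_one t
        have h4 := Real.neg_one_le_cos (l * t)
        have h5 := Real.exp_pos u
        have h6 := Real.exp_pos (l * u)
        have h7 : Real.exp u * Real.cos t ≤ Real.exp c := by nlinarith
        have h8 : -(z * Real.exp (l * u) * Real.cos (l * t)) ≤ z * Real.exp (l * c) := by
          have : z * Real.exp (l * u) ≤ z * Real.exp (l * c) := mul_le_mul_of_nonneg_left h2 hz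
          have h9 : 0 ≤ z * Real.exp (l * u) := by positivity
          nlinarith
        have h10 : b * u ≤ b * c := mul_le_mul_of_nonneg_left huc hb.le
        linarith
    refine squeeze_zero_norm' hb1 ?_
    have : Filter.Tendsto (fun θ : ℝ => θ) (nhdsWithin 0 (Set.Ioi 0)) (nhds 0) :=
      Filter.tendsto_id.mono_left nhdsWithin_le_nhds
    simpa using this.const_mul (Real.exp (Real.exp c + z * Real.exp (l * c) + b * c))
  · -- the end of the curve
    have hL : Filter.Tendsto (fun θ => c + curveL l θ) (nhdsWithin Real.pi (Set.Iio Real.pi))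
        Filter.atTop := by
      have hsl : 0 < Real.sin (l * Real.pi) :=
        Real.sin_pos_of_pos_of_lt_pi (by positivity) (by nlinarith [Real.pi_pos])
      have t1 : Filter.Tendsto (fun θ => Real.log (Real.sin (l * θ)))
          (nhdsWithin Real.pi (Set.Iio Real.pi)) (nhds (Real.log (Real.sin (l * Real.pi)))) := by
        have : ContinuousAt (fun θ => Real.log (Real.sin (l * θ))) Real.pi :=
          ContinuousAt.log (by fun_prop) hsl.ne'
        exact this.tendsto.mono_left nhdsWithin_le_nhds
      have t2 : Filter.Tendsto Real.sin (nhdsWithin Real.pi (Set.Iio Real.pi))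
          (nhdsWithin 0 (Set.Ioi 0)) := by
        refine tendsto_nhdsWithin_iff.mpr ⟨?_, ?_⟩
        · have := Real.continuous_sin.continuousAt (x := Real.pi)
          rw [ContinuousAt, Real.sin_pi] at this
          exact this.mono_left nhdsWithin_le_nhds
        · filter_upwards [Ioo_mem_nhdsLT Real.pi_pos] with θ hθ
          exact Real.sin_pos_of_pos_of_lt_pi hθ.1 hθ.2
      have t3 := Filter.tendsto_neg_atBot_atTop.comp (Real.tendsto_log_nhdsGT_zero.comp t2)
      have t4 := (t1.add_atTop t3).atTop_div_const hl
      exact Filter.tendsto_atTop_add_const_left _ c t4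
    obtain ⟨C, hC⟩ := aux_young l (4 * z) hl0 hl1 (by positivity)
    set D := Real.exp (C / 4 + b * Real.log (8 * b)) with hD
    have hb1 : ∀ᶠ θ : ℝ in nhdsWithin Real.pi (Set.Iio Real.pi),
        ‖(Φ ((c + curveL l θ : ℝ) + θ * Complex.I)).im -
          (Φ ((c + curveL l θ : ℝ) + Real.pi * Complex.I)).im‖ ≤ D * (Real.pi - θ) := by
      have hm : Set.Ioo (2 * Real.pi / 3) Real.pi ∈ nhdsWithin Real.pi (Set.Iio Real.pi) :=
        Ioo_mem_nhdsLT (by linarith [Real.pi_pos])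
      filter_upwards [hm] with θ hθ
      have h := prim_vertical hΦ (c + curveL l θ) θ Real.pi D hθ.2.le ?_
      · rw [Real.norm_eq_abs, abs_sub_comm]
        exact h
      · intro t ht
        rw [hankelH_norm, hD]
        refine Real.exp_le_exp.mpr ?_
        generalize c + curveL l θ = u
        have h1 : Real.cos t ≤ -(1 / 2) := by
          have : Real.cos (2 * Real.pi / 3) = -(1 / 2) := by
            rw [show 2 * Real.pi / 3 = Real.pi - Real.pi / 3 by ring, Real.cos_pi_sub,
              Real.cos_pi_div_three]
          rw [← this]
          exact Real.cos_le_cos_of_nonneg_of_le_pi (by positivity) ht.2 (by linarith [hθ.1, ht.1])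
        have h2 := hC (Real.exp u) (Real.exp_pos u).le
        rw [← Real.exp_mul, mul_comm u l] at h2
        have h4 := Real.neg_one_le_cos (l * t)
        have h5 := Real.exp_pos u
        have h6 := Real.exp_pos (l * u)
        have h7 : Real.exp u * Real.cos t ≤ -(1 / 2) * Real.exp u := by nlinarith
        have h8 : -(z * Real.exp (l * u) * Real.cos (l * t)) ≤ z * Real.exp (l * u) := by
          have h9 : 0 ≤ z * Real.exp (l * u) := by positivity
          nlinarith
        have h10 : b * u ≤ Real.exp u / 8 + b * Real.log (8 * b) := by
          have := Real.add_one_le_exp (u - Real.log (8 * b))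
          rw [Real.exp_sub, Real.exp_log (by positivity)] at this
          have h11 : b * (u - Real.log (8 * b)) ≤ b * (Real.exp u / (8 * b)) :=
            mul_le_mul_of_nonneg_left (by linarith) hb.le
          have h12 : b * (Real.exp u / (8 * b)) = Real.exp u / 8 := by field_simp
          linarith
        linarith
    have hz0 : Filter.Tendsto (fun θ : ℝ => (Φ ((c + curveL l θ : ℝ) + θ * Complex.I)).im -
          (Φ ((c + curveL l θ : ℝ) + Real.pi * Complex.I)).im)
          (nhdsWithin Real.pi (Set.Iio Real.pi)) (nhds 0) := by
      refine squeeze_zero_norm' hb1 ?_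
      have : ContinuousAt (fun θ : ℝ => D * (Real.pi - θ)) Real.pi := by fun_prop
      have := this.tendsto.mono_left (nhdsWithin_le_nhds (s := Set.Iio Real.pi))
      simpa using this
    have := hz0.add (hray.comp hL)
    simpa using this

lemma limit_le (N N' : ℝ → ℝ) (L0 L1 : ℝ)
    (hd : ∀ θ, 0 < θ → θ < Real.pi → HasDerivAt N (N' θ) θ)
    (hn : ∀ θ, 0 < θ → θ < Real.pi → 0 ≤ N' θ)
    (h0 : Filter.Tendsto N (nhdsWithin 0 (Set.Ioi 0)) (nhds L0))
    (h1 : Filter.Tendsto N (nhdsWithin Real.pi (Set.Iio Real.pi)) (nhds L1)) : L0 ≤ L1 := by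
  have hmono : MonotoneOn N (Set.Ioo 0 Real.pi) := by
    refine monotoneOn_of_deriv_nonneg (convex_Ioo _ _) ?_ ?_ ?_
    · exact fun θ hθ => (hd θ hθ.1 hθ.2).continuousAt.continuousWithinAt
    · rw [interior_Ioo]
      exact fun θ hθ => (hd θ hθ.1 hθ.2).differentiableAt.differentiableWithinAt
    · rw [interior_Ioo]
      intro θ hθ
      rw [(hd θ hθ.1 hθ.2).deriv]
      exact hn θ hθ.1 hθ.2
  have hm : Real.pi / 2 ∈ Set.Ioo 0 Real.pi := ⟨by positivity, by linarith [Real.pi_pos]⟩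
  have ha : L0 ≤ N (Real.pi / 2) := by
    refine le_of_tendsto h0 ?_
    filter_upwards [Ioo_mem_nhdsGT hm.1] with θ hθ
    exact hmono ⟨hθ.1, hθ.2.trans hm.2⟩ hm hθ.2.le
  have hb : N (Real.pi / 2) ≤ L1 := by
    refine ge_of_tendsto h1 ?_
    filter_upwards [Ioo_mem_nhdsLT hm.2] with θ hθ
    exact hmono hm ⟨hm.1.trans hθ.1, hθ.2⟩ hθ.1.le
  exact ha.trans hb

lemma exp_log_scale (l z : ℝ) (hl1 : l < 1) (hz : 0 < z) :
    Real.exp ((1 - l) * (Real.log z / (1 - l))) = z := by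
  rw [mul_div_cancel₀ _ (by linarith), Real.exp_log hz]

lemma wrightS_nonneg (l b z : ℝ) (hl0 : 0 < l) (hl1 : l < 1) (hb : 0 < b) (hb1 : b ≤ 1)
    (hz : 0 < z) : 0 ≤ wrightS l b z := by
  obtain ⟨N, hN, h0, h1⟩ := curve_rep l b (Real.log z / (1 - l)) hl0 hl1 hb
  rw [exp_log_scale l z hl1 hz] at h1
  have := limit_le N _ _ _ hN (fun θ a c => mul_nonneg (by positivity)
    (curveW_nonneg l b θ hl0 hl1 hb hb1 a c)) h0 h1
  exact nonneg_of_mul_nonneg_right this Real.pi_pos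

lemma wrightS_decay (l b : ℝ) (hl0 : 0 < l) (hl1 : l < 1) (hb : 0 < b) (hb1 : b ≤ 1) :
    ∃ z0 > 0, ∀ z w, z0 ≤ z → z ≤ w → w ^ 2 * wrightS l b w ≤ z ^ 2 * wrightS l b z := by
  obtain ⟨K0, hK0, hK⟩ := curveK_lower l hl0 hl1
  have hl : 0 < 1 - l := by linarith
  set m := 2 * (1 - l) + b with hm
  have hm0 : 0 < m := by positivity
  refine ⟨Real.exp ((1 - l) * Real.log (m / K0)), Real.exp_pos _, fun z w hz hw => ?_⟩
  have hz0 : 0 < z := (Real.exp_pos _).trans_le hz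
  have hw0 : 0 < w := hz0.trans_le hw
  obtain ⟨c, hc⟩ : ∃ c, c = Real.log z / (1 - l) := ⟨_, rfl⟩
  obtain ⟨d, hd⟩ : ∃ d, d = Real.log w / (1 - l) := ⟨_, rfl⟩
  have ez : Real.exp ((1 - l) * c) = z := by rw [hc]; exact exp_log_scale l z hl1 hz0
  have ew : Real.exp ((1 - l) * d) = w := by rw [hd]; exact exp_log_scale l w hl1 hw0
  have hcd : c ≤ d := by
    rw [hc, hd]
    exact div_le_div_of_nonneg_right (Real.log_le_log hz0 hw) hl.le
  have hcm : m ≤ K0 * Real.exp c := by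
    rw [← ez, Real.exp_le_exp] at hz
    have h1 : Real.log (m / K0) ≤ c := le_of_mul_le_mul_left hz hl
    have h2 := Real.exp_le_exp.mpr h1
    rw [Real.exp_log (by positivity), div_le_iff₀ hK0] at h2
    linarith
  obtain ⟨N, hN, h0, h1⟩ := curve_rep l b c hl0 hl1 hb
  obtain ⟨P, hP, p0, p1⟩ := curve_rep l b d hl0 hl1 hb
  rw [ez] at h1
  rw [ew] at p1
  have key := limit_le (fun θ => z ^ 2 * N θ - w ^ 2 * P θ) _ _ _
    (fun θ a a' => ((hN θ a a').const_mul (z ^ 2)).sub ((hP θ a a').const_mul (w ^ 2))) ?_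
    ((h0.const_mul _).sub (p0.const_mul _)) ((h1.const_mul _).sub (p1.const_mul _))
  · have := Real.pi_pos
    have e : Real.pi * (w ^ 2 * wrightS l b w) ≤ Real.pi * (z ^ 2 * wrightS l b z) := by linarith
    exact le_of_mul_le_mul_left e this
  · intro θ a a'
    have hW := curveW_nonneg l b θ hl0 hl1 hb hb1 a a'
    have hKθ := hK θ a a'
    have e1 : ∀ c : ℝ, Real.exp ((1 - l) * c) ^ 2 * (Real.exp (b * c) *
        Real.exp (-Real.exp c * curveK l θ) * curveW l b θ) =
        Real.exp (m * c - Real.exp c * curveK l θ) * curveW l b θ := by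
      intro c
      rw [← Real.exp_nat_mul, ← mul_assoc, ← Real.exp_add, ← Real.exp_add, hm]
      push_cast
      ring_nf
    rw [← ez, ← ew, e1, e1, sub_nonneg]
    refine mul_le_mul_of_nonneg_right (Real.exp_le_exp.mpr ?_) hW
    have h3 : Real.exp c * (d - c) ≤ Real.exp d - Real.exp c := by
      have := Real.add_one_le_exp (d - c)
      have h4 : Real.exp d = Real.exp c * Real.exp (d - c) := by rw [← Real.exp_add]; ring_nf
      rw [h4]
      nlinarith [Real.exp_pos c]
    have h5 : m * (d - c) ≤ K0 * Real.exp c * (d - c) :=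
      mul_le_mul_of_nonneg_right hcm (by linarith)
    have h6 : K0 * (Real.exp c * (d - c)) ≤ K0 * (Real.exp d - Real.exp c) :=
      mul_le_mul_of_nonneg_left h3 hK0.le
    have h7 : K0 * (Real.exp d - Real.exp c) ≤ curveK l θ * (Real.exp d - Real.exp c) :=
      mul_le_mul_of_nonneg_right hKθ (by linarith [Real.exp_le_exp.mpr hcd])
    linarith

lemma wright_summable (l b z : ℝ) (hl0 : 0 < l) (hl1 : l < 1) (hb : 0 < b) (hz : 0 ≤ z) :
    Summable fun n : ℕ => z ^ n / (n.factorial : ℝ) * |(Real.Gamma (1 - (b + l * n)))⁻¹| := by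
  refine Summable.of_nonneg_of_le (fun n => by positivity) ?_
    ((aux_summable l b z hl0 hl1 hb hz).mul_left Real.pi⁻¹)
  intro n
  have hpos : 0 < b + l * n := by positivity
  have h := aux_reflect _ hpos
  have hG := Real.Gamma_pos_of_pos hpos
  have e : (Real.Gamma (1 - (b + l * n)))⁻¹ =
      Real.pi⁻¹ * (Real.sin (Real.pi * (b + l * n)) * Real.Gamma (b + l * n)) := by
    rw [h]; field_simp
  rw [e, abs_mul, abs_mul, abs_of_pos (inv_pos.mpr Real.pi_pos), abs_of_pos hG]
  have h1 := Real.abs_sin_le_one (Real.pi * (b + l * n))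
  have h2 : |Real.sin (Real.pi * (b + l * n))| * Real.Gamma (b + l * n) ≤ Real.Gamma (b + l * n) :=
    mul_le_of_le_one_left hG.le h1
  have h3 : 0 ≤ z ^ n / (n.factorial : ℝ) * Real.pi⁻¹ := by positivity
  calc _ = (z ^ n / (n.factorial : ℝ) * Real.pi⁻¹) *
        (|Real.sin (Real.pi * (b + l * n))| * Real.Gamma (b + l * n)) := by ring
    _ ≤ (z ^ n / (n.factorial : ℝ) * Real.pi⁻¹) * Real.Gamma (b + l * n) :=
        mul_le_mul_of_nonneg_left h2 h3
    _ = _ := by ring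

lemma wright_summable' (l b z : ℝ) (hl0 : 0 < l) (hl1 : l < 1) (hb : 0 < b) :
    Summable fun n : ℕ => (-z) ^ n / ((n.factorial : ℝ) * Real.Gamma (1 - (b + l * n))) := by
  refine Summable.of_norm_bounded (wright_summable l b |z| hl0 hl1 hb (abs_nonneg z)) ?_
  intro n
  rw [norm_div, norm_mul, norm_pow, norm_neg, Real.norm_eq_abs, Real.norm_eq_abs, Real.norm_eq_abs,
    abs_inv, Nat.abs_cast, div_mul_eq_div_div, div_eq_mul_inv (|z| ^ n / _)]

lemma mainardi_one (l z : ℝ) : mainardiR l 1 z = wrightS l l z := by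
  unfold mainardiR wrightS
  refine tsum_congr fun n => ?_
  rw [show 1 - ((n : ℝ) + 1) * l = 1 - (l + l * n) by ring]

/-- Terms of the derivative of the second Mainardi function. -/
noncomputable def gDer (l : ℝ) (n : ℕ) (z : ℝ) : ℝ :=
  (n * (-z) ^ (n - 1) * (-1)) / ((n.factorial : ℝ) * Real.Gamma (2 - ((n : ℝ) + 1) * l))

lemma gDer_succ (l z : ℝ) (n : ℕ) : gDer l (n + 1) z =
    -((-z) ^ n / ((n.factorial : ℝ) * Real.Gamma (1 - ((2 * l - 1) + l * n)))) := by
  unfold gDer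
  have h1 : ((n : ℝ) + 1) ≠ 0 := by positivity
  have h2 : (n.factorial : ℝ) ≠ 0 := by positivity
  rw [Nat.factorial_succ]
  push_cast
  rw [show 2 - ((n : ℝ) + 1 + 1) * l = 1 - ((2 * l - 1) + l * n) by ring,
    div_eq_mul_inv, mul_inv, div_eq_mul_inv ((-z) ^ n), mul_inv (n.factorial : ℝ)]
  generalize (Real.Gamma (1 - ((2 * l - 1) + l * n)))⁻¹ = G
  field_simp

lemma gDer_summable (l z : ℝ) (hl0 : 1 / 2 < l) (hl1 : l < 1) : Summable fun n => gDer l n z := by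
  rw [← summable_nat_add_iff 1]
  simp_rw [gDer_succ]
  exact (wright_summable' l (2 * l - 1) z (by linarith) hl1 (by linarith)).neg

lemma gDer_tsum (l z : ℝ) (hl0 : 1 / 2 < l) (hl1 : l < 1) :
    ∑' n, gDer l n z = -wrightS l (2 * l - 1) z := by
  rw [(gDer_summable l z hl0 hl1).tsum_eq_zero_add]
  simp_rw [gDer_succ]
  rw [tsum_neg, wrightS]
  simp [gDer]

lemma mainardi_two_deriv (l z : ℝ) (hl0 : 1 / 2 < l) (hl1 : l < 1) :
    HasDerivAt (mainardiR l 2) (-wrightS l (2 * l - 1) z) z := by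
  rw [← gDer_tsum l z hl0 hl1]
  obtain ⟨R, hR⟩ : ∃ R, R = |z| + 1 := ⟨_, rfl⟩
  have hR0 : 0 < R := by rw [hR]; positivity
  have hu : Summable fun n => |gDer l n (-R)| := (gDer_summable l (-R) hl0 hl1).abs
  refine hasDerivAt_tsum_of_isPreconnected (t := Metric.ball 0 R) (y₀ := 0) hu Metric.isOpen_ball
    (convex_ball _ _).isPreconnected ?_ ?_ (Metric.mem_ball_self hR0) ?_ ?_
  · intro n y _
    exact (((hasDerivAt_neg y).pow n).div_const _)
  · intro n y hy
    rw [mem_ball_zero_iff, Real.norm_eq_abs] at hy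
    rw [Real.norm_eq_abs]
    unfold gDer
    rw [abs_div, abs_div]
    refine div_le_div_of_nonneg_right ?_ (abs_nonneg _)
    rw [abs_mul, abs_mul, abs_mul, abs_mul, abs_pow, abs_pow, abs_neg, neg_neg, abs_of_pos hR0]
    gcongr
  · refine summable_of_ne_finset_zero (s := {0}) ?_
    intro n hn
    have : n ≠ 0 := by simpa using hn
    simp [this]
  · rw [mem_ball_zero_iff, Real.norm_eq_abs, hR]; linarith

lemma mainardi_two_antitone (l z w : ℝ) (hl0 : 1 / 2 < l) (hl1 : l < 1) (hz : 0 ≤ z)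
    (hzw : z ≤ w) : mainardiR l 2 w ≤ mainardiR l 2 z := by
  have : AntitoneOn (mainardiR l 2) (Set.Ici 0) := by
    refine antitoneOn_of_deriv_nonpos (convex_Ici _) ?_ ?_ ?_
    · exact fun y _ => (mainardi_two_deriv l y hl0 hl1).continuousAt.continuousWithinAt
    · exact fun y _ => (mainardi_two_deriv l y hl0 hl1).differentiableAt.differentiableWithinAt
    · rw [interior_Ici]
      intro y hy
      rw [(mainardi_two_deriv l y hl0 hl1).deriv]
      have := wrightS_nonneg l (2 * l - 1) y (by linarith) hl1 (by linarith) (by linarith) hy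
      linarith
  exact this hz (hz.trans hzw : (0:ℝ) ≤ w) hzw

lemma mainardi_two_identity (l z : ℝ) (hl0 : 1 / 2 < l) (hl1 : l < 1) :
    (1 - l) * mainardiR l 2 z = wrightS l l z - l * z * wrightS l (2 * l - 1) z := by
  have s1 := (wright_summable' l l z (by linarith) hl1 (by linarith)).hasSum
  have s2 := ((gDer_summable l z hl0 hl1).hasSum).mul_left (l * z)
  rw [gDer_tsum l z hl0 hl1] at s2
  have s3 := (s1.add s2).tsum_eq
  have e : ∀ n : ℕ, (-z) ^ n / ((n.factorial : ℝ) * Real.Gamma (1 - (l + l * n))) +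
      l * z * gDer l n z =
      (1 - l) * ((-z) ^ n / ((n.factorial : ℝ) * Real.Gamma (2 - ((n : ℝ) + 1) * l))) := by
    intro n
    have hrec : (Real.Gamma (1 - (l + l * n)))⁻¹ =
        (1 - (l + l * n)) * (Real.Gamma (2 - ((n : ℝ) + 1) * l))⁻¹ := by
      rw [show 2 - ((n : ℝ) + 1) * l = (1 - (l + l * n)) + 1 by ring]
      by_cases hs : 1 - (l + l * n) = 0
      · rw [hs, Real.Gamma_zero]; simp
      · rw [Real.Gamma_add_one hs, mul_inv, ← mul_assoc, mul_inv_cancel₀ hs, one_mul]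
    have hpow : z * (n * (-z) ^ (n - 1) * (-1)) = n * (-z) ^ n := by
      cases n with
      | zero => simp
      | succ k => rw [Nat.add_sub_cancel, pow_succ]; ring
    unfold gDer
    rw [div_eq_mul_inv, mul_inv, hrec, mul_div_assoc', mul_assoc l z, hpow, div_eq_mul_inv, mul_inv,
      div_eq_mul_inv, mul_inv]
    ring
  simp_rw [e] at s3
  rw [tsum_mul_left] at s3
  unfold mainardiR
  rw [s3]
  unfold wrightS
  ring

lemma mainardi_two_nonneg (l z : ℝ) (hl0 : 1 / 2 < l) (hl1 : l < 1) (hz : 0 ≤ z) :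
    0 ≤ mainardiR l 2 z := by
  obtain ⟨z0, hz0, hdec⟩ := wrightS_decay l (2 * l - 1) (by linarith) hl1 (by linarith)
    (by linarith)
  set C := z0 ^ 2 * wrightS l (2 * l - 1) z0 with hC
  have hlim : Filter.Tendsto (fun w : ℝ => -(l * C) * w⁻¹) Filter.atTop (nhds (-(l * C) * 0)) :=
    tendsto_inv_atTop_zero.const_mul _
  rw [mul_zero] at hlim
  have h : 0 ≤ (1 - l) * mainardiR l 2 z := by
    refine le_of_tendsto hlim ?_
    filter_upwards [Filter.eventually_ge_atTop z0, Filter.eventually_ge_atTop z] with w hw0 hw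
    have hwp : 0 < w := hz0.trans_le hw0
    have h1 := mainardi_two_antitone l z w hl0 hl1 hz hw
    have h2 := mainardi_two_identity l w hl0 hl1
    have h3 := wrightS_nonneg l l w (by linarith) hl1 (by linarith) hl1.le hwp
    have h4 := hdec z0 w le_rfl hw0
    have h5 : w * wrightS l (2 * l - 1) w ≤ C * w⁻¹ := by
      rw [← div_eq_mul_inv, le_div_iff₀ hwp]
      linarith
    have h6 : (1 - l) * mainardiR l 2 w ≤ (1 - l) * mainardiR l 2 z :=
      mul_le_mul_of_nonneg_left h1 (by linarith)
    have h7 : l * (w * wrightS l (2 * l - 1) w) ≤ l * (C * w⁻¹) :=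
      mul_le_mul_of_nonneg_left h5 (by linarith)
    linarith
  exact nonneg_of_mul_nonneg_right h (by linarith)

/-- Elementary geometry of the comparison. -/
lemma geom_aux (l t x z0 : ℝ) (hl0 : 0 < l) (ht : 0 < t) (hz0 : 0 < z0) :
    ∃ A : ℝ, 0 < A ∧
      ∀ t' x' : ℝ, 0 < t' → t' ≤ t + 1 / 2 → |x - x'| ≤ 1 →
        ∀ s : ℝ, 0 ≤ s → s < t' →
          ∀ y : ℝ, A ≤ |y| → 0 < |x' - y| ∧ 0 < |x - y| ∧
            |x - y| ^ 2 * (t' - s) ^ l ≤ |x' - y| ^ 2 * (t + 1 - s) ^ l ∧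
            |x - y| / (t + 1 - s) ^ l ≤ |x' - y| / (t' - s) ^ l ∧
            z0 ≤ |x - y| / (t + 1 - s) ^ l := by
  obtain ⟨k0, hk0⟩ : ∃ k0, k0 = (t + 1 / 2) / (t + 1) := ⟨_, rfl⟩
  have hk00 : 0 < k0 := by rw [hk0]; positivity
  have hk01 : k0 < 1 := by rw [hk0, div_lt_one (by positivity)]; linarith
  obtain ⟨k, hk⟩ : ∃ k, k = k0 ^ l := ⟨_, rfl⟩
  have hkp : 0 < k := by rw [hk]; positivity
  have hk1 : k < 1 := by rw [hk]; exact Real.rpow_lt_one hk00.le hk01 hl0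
  have hk1' : 0 < 1 - k := by linarith
  refine ⟨|x| + 2 / (1 - k) + z0 * (t + 1) ^ l, by positivity, ?_⟩
  intro t' x' ht' htt hxx s hs hst y hy
  have hq : 0 < z0 * (t + 1) ^ l := by positivity
  have hq2 : 0 < 2 / (1 - k) := by positivity
  have hX1 : |y| - |x| ≤ |x - y| := by
    rw [abs_sub_comm]; exact abs_sub_abs_le_abs_sub y x
  have hX2 : |x - y| - 1 ≤ |x' - y| := by
    have : |x - y| ≤ |x - x'| + |x' - y| := abs_sub_le x x' y
    linarith
  have hXa : 2 / (1 - k) ≤ |x - y| := by linarith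
  have hXb : z0 * (t + 1) ^ l ≤ |x - y| := by linarith
  generalize |x - y| = X at *
  generalize |x' - y| = X' at *
  rw [div_le_iff₀ hk1'] at hXa
  have hXpos : 0 < X := by linarith
  have hX'k : k * X ≤ X' := by linarith
  have hX2' : 2 ≤ X := by nlinarith
  have hX'pos : 0 < X' := by linarith
  have hsq : k * X ^ 2 ≤ X' ^ 2 := by nlinarith
  have hτ : 0 < t' - s := by linarith
  have hT : 0 < t + 1 - s := by linarith
  have hτT : t' - s ≤ k0 * (t + 1 - s) := by
    have : k0 * (t + 1) = t + 1 / 2 := by rw [hk0]; field_simp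
    nlinarith
  have hp : (t' - s) ^ l ≤ k * (t + 1 - s) ^ l := by
    rw [hk, ← Real.mul_rpow hk00.le hT.le]
    exact Real.rpow_le_rpow hτ.le hτT hl0.le
  have hP : (t + 1 - s) ^ l ≤ (t + 1) ^ l := Real.rpow_le_rpow hT.le (by linarith) hl0.le
  have hp0 : 0 < (t' - s) ^ l := by positivity
  have hP0 : 0 < (t + 1 - s) ^ l := by positivity
  generalize (t' - s) ^ l = p at *
  generalize (t + 1 - s) ^ l = P at *
  refine ⟨hX'pos, hXpos, ?_, ?_, ?_⟩
  · calc X ^ 2 * p ≤ X ^ 2 * (k * P) := mul_le_mul_of_nonneg_left hp (by positivity)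
      _ = k * X ^ 2 * P := by ring
      _ ≤ X' ^ 2 * P := mul_le_mul_of_nonneg_right hsq hP0.le
  · rw [div_le_div_iff₀ hP0 hp0]
    calc X * p ≤ X * (k * P) := mul_le_mul_of_nonneg_left hp (by positivity)
      _ = k * X * P := by ring
      _ ≤ X' * P := mul_le_mul_of_nonneg_right hX'k hP0.le
  · rw [le_div_iff₀ hP0]
    exact (mul_le_mul_of_nonneg_left hP hz0.le).trans hXb

/-- for `β ∈ (0,2)`, `t > 0` and `x ∈ ℝ`, there is `A > 0` such that for all
`(t′,x′)` with `0 < t′ ≤ t + 1/2` and `|x − x′| ≤ 1`, all `s ∈ [0, t′)` and all `y` with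
`|y| ≥ A`, one has `G_β(t′ − s, x′ − y) ≤ G_β(t + 1 − s, x − y)`. -/
theorem greenG_tail_comparison (β : ℝ) (hβ0 : 0 < β) (hβ2 : β < 2)
    (t x : ℝ) (ht : 0 < t) :
    ∃ A : ℝ, 0 < A ∧
      ∀ t' x' : ℝ, 0 < t' → t' ≤ t + 1 / 2 → |x - x'| ≤ 1 →
        ∀ s : ℝ, 0 ≤ s → s < t' →
          ∀ y : ℝ, A ≤ |y| →
            greenG β (t' - s) (x' - y) ≤ greenG β (t + 1 - s) (x - y) := by
  obtain ⟨l, hl⟩ : ∃ l, l = β / 2 := ⟨_, rfl⟩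
  have hl0 : 0 < l := by rw [hl]; linarith
  have hl1 : l < 1 := by rw [hl]; linarith
  rcases le_or_gt β 1 with h1 | h1
  · have hceil : ⌈β⌉₊ = 1 := by
      rw [Nat.ceil_eq_iff (by norm_num)]
      constructor
      · simpa using hβ0
      · simpa using h1
    obtain ⟨z0, hz0, hdec⟩ := wrightS_decay l l hl0 hl1 hl0 hl1.le
    obtain ⟨A, hA, hall⟩ := geom_aux l t x z0 hl0 ht hz0
    refine ⟨A, hA, ?_⟩
    intro t' x' ht' htt hxx s hs hst y hy
    obtain ⟨hX', hX, hsq, hzw, hz⟩ := hall t' x' ht' htt hxx s hs hst y hy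
    have hτ : 0 < t' - s := by linarith
    have hT : 0 < t + 1 - s := by linarith
    unfold greenG
    rw [hceil, ← hl, Nat.cast_one, mainardi_one, mainardi_one, show (1:ℝ) - 1 - l = -l by ring,
      Real.rpow_neg hτ.le, Real.rpow_neg hT.le]
    have hp0 : 0 < (t' - s) ^ l := by positivity
    have hP0 : 0 < (t + 1 - s) ^ l := by positivity
    have hd := hdec _ _ hz hzw
    have hnn := wrightS_nonneg l l (|x - y| / (t + 1 - s) ^ l) hl0 hl1 hl0 hl1.le (by positivity)
    generalize |x - y| = X at *
    generalize |x' - y| = X' at *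
    generalize (t' - s) ^ l = p at *
    generalize (t + 1 - s) ^ l = P at *
    generalize wrightS l l (X / P) = M at *
    generalize wrightS l l (X' / p) = M' at *
    have e1 : p⁻¹ / 2 * M' = ((X' / p) ^ 2 * M') * (p / X' ^ 2 / 2) := by field_simp
    rw [e1]
    refine (mul_le_mul_of_nonneg_right hd (by positivity)).trans ?_
    have e2 : (X / P) ^ 2 * M * (p / X' ^ 2 / 2) = (P⁻¹ / 2 * M) * (X ^ 2 * p / (X' ^ 2 * P)) := by
      field_simp
    rw [e2]
    refine mul_le_of_le_one_right (by positivity) ?_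
    rw [div_le_one (by positivity)]
    exact hsq
  · have hceil : ⌈β⌉₊ = 2 := by
      rw [Nat.ceil_eq_iff (by norm_num)]
      constructor
      · simpa using h1
      · simpa using hβ2.le
    have hl2 : 1 / 2 < l := by rw [hl]; linarith
    obtain ⟨A, hA, hall⟩ := geom_aux l t x 1 hl0 ht one_pos
    refine ⟨A, hA, ?_⟩
    intro t' x' ht' htt hxx s hs hst y hy
    obtain ⟨hX', hX, hsq, hzw, hz⟩ := hall t' x' ht' htt hxx s hs hst y hy
    have hτ : 0 < t' - s := by linarith
    have hT : 0 < t + 1 - s := by linarith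
    unfold greenG
    rw [hceil, ← hl, Nat.cast_ofNat, show (2:ℝ) - 1 - l = 1 - l by ring]
    have hnn : 0 ≤ |x - y| / (t + 1 - s) ^ l := by positivity
    refine mul_le_mul ?_ (mainardi_two_antitone l _ _ hl2 hl1 hnn hzw)
      (mainardi_two_nonneg l _ hl2 hl1 (by positivity)) (by positivity)
    have := Real.rpow_le_rpow hτ.le (by linarith : t' - s ≤ t + 1 - s) (by linarith : 0 ≤ 1 - l)
    linarith
end

section
/- Let β ∈ (1,2) and fix t > 0 and x ∈ ℝ. Then, with the convention G_β(r, z) = 0 for r ≤ 0, the map (t′, x′) ↦ ∫_0^∞ ∫_ℝ (G_β(t′ − s, x′ − y) − G_β(t − s, x − y))² dy ds tends to 0 as (t′, x′) → (t, x) in (0,∞) × ℝ. -/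
open MeasureTheory Filter

/-- The Green function extended by `0` to nonpositive times. -/
noncomputable def greenGext (β t x : ℝ) : ℝ :=
  if 0 < t then greenG β t x else 0

open Set Topology

section aux

lemma gm_norm_cexp (ζ : ℂ) (u : ℝ) : ‖Complex.exp (-ζ * u)‖ = Real.exp (-ζ.re * u) := by
  rw [Complex.norm_exp]; simp

lemma gm_int_rpow_exp {s b : ℝ} (hs : -1 < s) (hb : 0 < b) :
    IntegrableOn (fun u : ℝ => u ^ s * Real.exp (-b * u)) (Ioi 0) := by
  have := integrableOn_rpow_mul_exp_neg_mul_rpow hs one_pos hb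
  simpa using this

lemma gm_meas_rpow (s : ℝ) : Measurable (fun u : ℝ => ((u ^ s : ℝ) : ℂ)) := by fun_prop

lemma gm_int_cexp {s : ℝ} {ζ : ℂ} (hs : -1 < s) (hζ : 0 < ζ.re) :
    IntegrableOn (fun u : ℝ => Complex.exp (-ζ * u) * ((u ^ s : ℝ) : ℂ)) (Ioi 0) := by
  refine (gm_int_rpow_exp hs hζ).mono' (by fun_prop) ?_
  filter_upwards [ae_restrict_mem measurableSet_Ioi] with u hu
  rw [norm_mul, gm_norm_cexp, Complex.norm_real, Real.norm_of_nonneg (Real.rpow_nonneg (le_of_lt hu) _), mul_comm]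

lemma gm_hasDerivAt {s : ℝ} (hs : 0 < s) {ζ : ℂ} (hζ : 0 < ζ.re) :
    HasDerivAt (fun ζ : ℂ => ∫ u in Ioi (0:ℝ), Complex.exp (-ζ * u) * ((u ^ (s-1) : ℝ) : ℂ))
      (∫ u in Ioi (0:ℝ), (Complex.exp (-ζ * u) * (-u)) * ((u ^ (s-1) : ℝ) : ℂ)) ζ := by
  have hε : 0 < ζ.re / 2 := by linarith
  refine (hasDerivAt_integral_of_dominated_loc_of_deriv_le
    (bound := fun u : ℝ => u ^ s * Real.exp (-(ζ.re/2) * u)) (s := Metric.ball ζ (ζ.re/2))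
    (F' := fun ζ u => (Complex.exp (-ζ * u) * (-u)) * ((u ^ (s-1) : ℝ) : ℂ))
    (F := fun ζ u => Complex.exp (-ζ * u) * ((u ^ (s-1) : ℝ) : ℂ)) (μ := volume.restrict (Ioi 0))
    (Metric.ball_mem_nhds _ hε)
    (Eventually.of_forall fun z => by fun_prop) (gm_int_cexp (by linarith) hζ) (by fun_prop) ?_
    (gm_int_rpow_exp (by linarith) hε) ?_).2
  · filter_upwards [ae_restrict_mem measurableSet_Ioi] with u hu z hz
    have hu0 : (0:ℝ) < u := hu
    have hre : ζ.re / 2 ≤ z.re := by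
      have h1 : |(z - ζ).re| ≤ ‖z - ζ‖ := Complex.abs_re_le_norm _
      rw [Metric.mem_ball, dist_eq_norm] at hz
      have h2 := (abs_le.1 (h1.trans hz.le)).1
      simp at h2; linarith
    rw [norm_mul, norm_mul, gm_norm_cexp, Complex.norm_real, norm_neg, Complex.norm_real,
      Real.norm_of_nonneg (Real.rpow_nonneg hu0.le _), Real.norm_of_nonneg hu0.le]
    have : u ^ s = u * u ^ (s-1) := by
      rw [Real.rpow_sub_one hu0.ne']; field_simp
    rw [this]
    have h3 : Real.exp (-z.re * u) ≤ Real.exp (-(ζ.re/2) * u) := by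
      apply Real.exp_le_exp.2; nlinarith
    have h4 : 0 ≤ u * u ^ (s-1) := by positivity
    calc Real.exp (-z.re * u) * u * u ^ (s-1) = (u * u ^ (s-1)) * Real.exp (-z.re * u) := by ring
      _ ≤ _ := by gcongr
  · filter_upwards [ae_restrict_mem measurableSet_Ioi] with u hu z hz
    have h1 : HasDerivAt (fun z : ℂ => -z * (u:ℂ)) (-(u:ℂ)) z := by
      simpa using ((hasDerivAt_id z).neg.mul_const (u:ℂ))
    exact (h1.cexp).mul_const _

lemma gm_gammaC {s : ℝ} (hs : 0 < s) {ζ : ℂ} (hζ : 0 < ζ.re) :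
    ∫ u in Ioi (0:ℝ), Complex.exp (-ζ * u) * ((u ^ (s-1) : ℝ) : ℂ)
      = (Real.Gamma s : ℂ) * ζ ^ (-(s:ℂ)) := by
  have hopen : IsOpen {z : ℂ | 0 < z.re} := isOpen_lt continuous_const Complex.continuous_re
  have hconv : Convex ℝ {z : ℂ | 0 < z.re} := convex_halfSpace_re_gt 0
  have hF : AnalyticOnNhd ℂ (fun ζ : ℂ => ∫ u in Ioi (0:ℝ), Complex.exp (-ζ * u) * ((u ^ (s-1) : ℝ) : ℂ))
      {z : ℂ | 0 < z.re} := by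
    apply DifferentiableOn.analyticOnNhd _ hopen
    intro z hz
    exact (gm_hasDerivAt hs hz).differentiableAt.differentiableWithinAt
  have hG : AnalyticOnNhd ℂ (fun ζ : ℂ => (Real.Gamma s : ℂ) * ζ ^ (-(s:ℂ))) {z : ℂ | 0 < z.re} := by
    apply DifferentiableOn.analyticOnNhd _ hopen
    intro z hz
    have hz' : z ∈ Complex.slitPlane := Or.inl hz
    exact ((differentiableAt_id.cpow_const hz').const_mul _).differentiableWithinAt
  refine hF.eqOn_of_preconnected_of_frequently_eq hG hconv.isPreconnected (z₀ := 1) (by simp) ?_ hζ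
  have hreal : ∀ r : ℝ, 0 < r → ∫ u in Ioi (0:ℝ), Complex.exp (-(r:ℂ) * u) * ((u ^ (s-1) : ℝ) : ℂ)
      = (Real.Gamma s : ℂ) * (r:ℂ) ^ (-(s:ℂ)) := by
    intro r hr
    have := Real.integral_rpow_mul_exp_neg_mul_Ioi hs hr
    have h2 : ∀ u : ℝ, Complex.exp (-(r:ℂ) * u) * ((u ^ (s-1) : ℝ) : ℂ) =
      ((u ^ (s-1) * Real.exp (-(r * u)) : ℝ) : ℂ) := by
      intro u; push_cast; rw [mul_comm]; congr 2; ring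
    simp_rw [h2]
    rw [integral_complex_ofReal, this]
    have h3 : (r:ℂ) ^ (-(s:ℂ)) = ((r ^ (-s) : ℝ) : ℂ) := by
      rw [Complex.ofReal_cpow hr.le]; simp
    rw [h3, one_div, Real.inv_rpow hr.le, Real.rpow_neg hr.le]
    push_cast; ring
  have htend : Tendsto (fun n : ℕ => (((1:ℝ) + 1 / ((n:ℝ) + 1) : ℝ) : ℂ)) atTop (𝓝[≠] 1) := by
    refine tendsto_nhdsWithin_iff.2 ⟨?_, ?_⟩
    · have h1 : Tendsto (fun n : ℕ => (1:ℝ) + 1 / ((n:ℝ) + 1)) atTop (𝓝 (1 + 0)) :=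
        tendsto_const_nhds.add tendsto_one_div_add_atTop_nhds_zero_nat
      have := (Complex.continuous_ofReal.tendsto _).comp h1
      rw [add_zero, Complex.ofReal_one] at this
      exact this
    · refine Eventually.of_forall fun n => ?_
      simp only [mem_compl_iff, mem_singleton_iff]
      have : (0:ℝ) < 1 / ((n:ℝ) + 1) := by positivity
      norm_cast
      intro h
      have h' : (1:ℝ) + 1 / ((n:ℝ) + 1) = 1 := by exact_mod_cast h
      linarith
  refine htend.frequently (Frequently.of_forall fun n => ?_)
  exact hreal _ (by positivity)

lemma gm_exp_sub_one {ζ : ℂ} (hζ : 0 ≤ ζ.re) {u : ℝ} (hu : 0 ≤ u) :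
    ‖Complex.exp (-ζ * u) - 1‖ ≤ 2 ∧ ‖Complex.exp (-ζ * u) - 1‖ ≤ 2 * ‖ζ‖ * u := by
  have h1 : ‖Complex.exp (-ζ * u) - 1‖ ≤ 2 := by
    refine (norm_sub_le _ _).trans ?_
    rw [gm_norm_cexp, norm_one]
    have : Real.exp (-ζ.re * u) ≤ 1 := Real.exp_le_one_iff.2 (by nlinarith)
    linarith
  refine ⟨h1, ?_⟩
  have hn : ‖-ζ * (u:ℂ)‖ = ‖ζ‖ * u := by
    rw [norm_mul, norm_neg, Complex.norm_real, Real.norm_of_nonneg hu]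
  by_cases h : ‖ζ‖ * u ≤ 1
  · have := Complex.norm_exp_sub_one_le (x := -ζ * (u:ℂ)) (by rw [hn]; exact h)
    rw [hn] at this; linarith
  · linarith

lemma gm_int_J {a : ℝ} (ha0 : 0 < a) (ha1 : a < 1) {ζ : ℂ} (hζ : 0 ≤ ζ.re) :
    IntegrableOn (fun u : ℝ => (Complex.exp (-ζ * u) - 1) * ((u ^ (-a-1) : ℝ) : ℂ)) (Ioi 0) := by
  rw [← Ioc_union_Ioi_eq_Ioi (zero_le_one' ℝ), integrableOn_union]
  constructor
  · have h0 : IntegrableOn (fun u : ℝ => 2 * ‖ζ‖ * u ^ (-a)) (Ioc 0 1) := by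
      have := (intervalIntegral.intervalIntegrable_rpow' (a := 0) (b := 1) (r := -a) (by linarith))
      rw [intervalIntegrable_iff_integrableOn_Ioc_of_le zero_le_one] at this
      exact this.const_mul _
    refine h0.mono' (by fun_prop) ?_
    filter_upwards [ae_restrict_mem measurableSet_Ioc] with u hu
    have hu0 : 0 < u := hu.1
    rw [norm_mul, Complex.norm_real, Real.norm_of_nonneg (Real.rpow_nonneg hu0.le _)]
    calc _ ≤ (2 * ‖ζ‖ * u) * u ^ (-a-1) := by
          gcongr; exact (gm_exp_sub_one hζ hu0.le).2
      _ = _ := by rw [Real.rpow_sub_one hu0.ne']; field_simp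
  · have h0 : IntegrableOn (fun u : ℝ => 2 * u ^ (-a-1)) (Ioi 1) :=
      (integrableOn_Ioi_rpow_of_lt (by linarith) one_pos).const_mul _
    refine h0.mono' (by fun_prop) ?_
    filter_upwards [ae_restrict_mem measurableSet_Ioi] with u hu
    have hu0 : 0 < u := one_pos.trans hu
    rw [norm_mul, Complex.norm_real, Real.norm_of_nonneg (Real.rpow_nonneg hu0.le _)]
    gcongr; exact (gm_exp_sub_one hζ hu0.le).1

lemma gm_J {a : ℝ} (ha0 : 0 < a) (ha1 : a < 1) {ζ : ℂ} (hζ : 0 < ζ.re) :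
    ∫ u in Ioi (0:ℝ), (Complex.exp (-ζ * u) - 1) * ((u ^ (-a-1) : ℝ) : ℂ)
      = -((Real.Gamma (1-a) / a : ℝ) : ℂ) * ζ ^ (a:ℂ) := by
  have hζ0 : ζ ≠ 0 := by rintro rfl; simp at hζ
  have haC : (a:ℂ) ≠ 0 := by exact_mod_cast ha0.ne'
  have hnorm : ∀ u : ℝ, 0 < u → ‖((fun u : ℝ => Complex.exp (-ζ * u) - 1) * (fun u : ℝ => ((-(u ^ (-a)) / a : ℝ) : ℂ))) u‖
      = ‖Complex.exp (-ζ * u) - 1‖ * (u ^ (-a) / a) := by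
    intro u hu
    simp only [Pi.mul_apply]
    rw [norm_mul, Complex.norm_real, neg_div, norm_neg, Real.norm_of_nonneg (by positivity)]
  have hcomb2 : ∀ u : ℝ, (Complex.exp (-ζ * u) * (-ζ)) * ((-(u ^ (-a)) / a : ℝ) : ℂ)
        = (ζ / a) * (Complex.exp (-ζ * u) * ((u ^ ((1-a)-1) : ℝ) : ℂ)) := by
    intro u
    rw [show (1 - a) - 1 = -a by ring]; push_cast; ring
  have key := integral_Ioi_mul_deriv_eq_deriv_mul (a := (0:ℝ)) (A := ℂ)
    (u := fun u : ℝ => Complex.exp (-ζ * u) - 1) (u' := fun u : ℝ => Complex.exp (-ζ * u) * (-ζ))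
    (v := fun u : ℝ => ((-(u ^ (-a)) / a : ℝ) : ℂ)) (v' := fun u : ℝ => ((u ^ (-a-1) : ℝ) : ℂ))
    (a' := 0) (b' := 0) ?_ ?_ ?_ ?_ ?_ ?_
  · rw [key]
    simp_rw [hcomb2]
    rw [integral_const_mul, gm_gammaC (by linarith) hζ]
    have : ζ ^ (a:ℂ) = ζ * ζ ^ (-((1 - a : ℝ) : ℂ)) := by
      nth_rewrite 2 [← Complex.cpow_one ζ]
      rw [← Complex.cpow_add _ _ hζ0]; congr 1; push_cast; ring
    rw [this]; push_cast; field_simp; ring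
  · intro u hu
    have h1 : HasDerivAt (fun u : ℝ => -ζ * (u:ℂ)) (-ζ) u := by
      simpa using (Complex.ofRealCLM.hasDerivAt (x := u)).const_mul (-ζ)
    exact h1.cexp.sub_const 1
  · intro u hu
    have hu0 : (0:ℝ) < u := hu
    have h1 : HasDerivAt (fun u : ℝ => -(u ^ (-a)) / a) (u ^ (-a-1)) u := by
      have := ((Real.hasDerivAt_rpow_const (p := -a) (Or.inl hu0.ne')).neg).div_const a
      convert! this using 1
      field_simp
    exact h1.ofReal_comp
  · exact gm_int_J ha0 ha1 hζ.le
  · have : (fun u : ℝ => Complex.exp (-ζ * u) * (-ζ)) * (fun u : ℝ => ((-(u ^ (-a)) / a : ℝ) : ℂ))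
      = fun u : ℝ => (ζ / a) * (Complex.exp (-ζ * u) * ((u ^ ((1-a)-1) : ℝ) : ℂ)) := by
      funext u; exact hcomb2 u
    rw [this]
    exact (gm_int_cexp (by linarith) hζ).const_mul _
  · have h0 : Tendsto (fun u : ℝ => 2 * ‖ζ‖ / a * u ^ (1 - a)) (𝓝[>] 0) (𝓝 0) := by
      have : Tendsto (fun u : ℝ => 2 * ‖ζ‖ / a * u ^ (1 - a)) (𝓝 0) (𝓝 (2 * ‖ζ‖ / a * 0 ^ (1 - a))) :=
        ((Real.continuous_rpow_const (by linarith)).tendsto 0).const_mul _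
      rw [Real.zero_rpow (by linarith), mul_zero] at this
      exact this.mono_left nhdsWithin_le_nhds
    refine squeeze_zero_norm' ?_ h0
    filter_upwards [self_mem_nhdsWithin] with u hu
    have hu0 : (0:ℝ) < u := hu
    rw [hnorm u hu0]
    calc _ ≤ (2 * ‖ζ‖ * u) * (u ^ (-a) / a) := by
          gcongr; exact (gm_exp_sub_one hζ.le hu0.le).2
      _ = _ := by rw [sub_eq_add_neg, Real.rpow_add hu0, Real.rpow_one]; ring
  · have h0 : Tendsto (fun u : ℝ => 2 / a * u ^ (-a)) atTop (𝓝 0) := by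
      simpa using (tendsto_rpow_neg_atTop ha0).const_mul (2/a)
    refine squeeze_zero_norm' ?_ h0
    filter_upwards [eventually_gt_atTop 0] with u hu0
    rw [hnorm u hu0]
    calc _ ≤ 2 * (u ^ (-a) / a) := by
          gcongr; exact (gm_exp_sub_one hζ.le hu0.le).1
      _ = _ := by ring

lemma gm_cis_cpow {θ : ℝ} (h1 : -Real.pi < θ) (h2 : θ ≤ Real.pi) (a : ℂ) :
    (Complex.exp (θ * Complex.I)) ^ a = Complex.exp (θ * a * Complex.I) := by
  rw [Complex.cpow_def_of_ne_zero (Complex.exp_ne_zero _), Complex.log_exp (by simpa) (by simpa)]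
  congr 1; ring

/-- unit directions -/
noncomputable def gmP (φ : ℝ) : ℂ := Complex.exp (((φ - Real.pi : ℝ) : ℂ) * Complex.I)
noncomputable def gmQ (l φ : ℝ) : ℂ := Complex.exp (((l * φ : ℝ) : ℂ) * Complex.I)
noncomputable def gmE (l φ : ℝ) : ℂ := Complex.exp (((φ * (l - 1) : ℝ) : ℂ) * Complex.I)

lemma gmP_re {φ : ℝ} (h1 : Real.pi / 2 < φ) (h2 : φ < Real.pi) : 0 < (gmP φ).re := by
  rw [gmP, Complex.exp_ofReal_mul_I_re]
  apply Real.cos_pos_of_mem_Ioo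
  constructor <;> linarith

lemma gmQ_re {l φ : ℝ} (h1 : 0 < l * φ) (h2 : l * φ < Real.pi / 2) : 0 < (gmQ l φ).re := by
  rw [gmQ, Complex.exp_ofReal_mul_I_re]
  apply Real.cos_pos_of_mem_Ioo
  constructor <;> linarith [Real.pi_pos]

lemma gmP_norm (φ : ℝ) : ‖gmP φ‖ = 1 := by rw [gmP, Complex.norm_exp_ofReal_mul_I]
lemma gmQ_norm (l φ : ℝ) : ‖gmQ l φ‖ = 1 := by rw [gmQ, Complex.norm_exp_ofReal_mul_I]
lemma gmE_norm (l φ : ℝ) : ‖gmE l φ‖ = 1 := by rw [gmE, Complex.norm_exp_ofReal_mul_I]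

lemma gm_reflect {s : ℝ} (hs : 0 < s) :
    Real.Gamma s * Real.sin (Real.pi * s) / Real.pi = 1 / Real.Gamma (1 - s) := by
  have h := Real.Gamma_mul_Gamma_one_sub s
  have hg := (Real.Gamma_pos_of_pos hs).ne'
  have hpi := Real.pi_ne_zero
  by_cases h0 : Real.sin (Real.pi * s) = 0
  · rw [h0, div_zero] at h
    have : Real.Gamma (1 - s) = 0 := by
      rcases mul_eq_zero.1 h with h | h
      · exact absurd h hg
      · exact h
    rw [h0, this]; simp
  · have h3 : Real.Gamma (1 - s) ≠ 0 := by
      intro h4; rw [h4, mul_zero] at h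
      exact (div_ne_zero hpi h0) h.symm
    field_simp
    rw [eq_div_iff h0] at h
    linarith

lemma gm_term0 {l φ : ℝ} (hl : 1/2 < l) (hl1 : l < 1) (h1 : Real.pi / 2 < φ) (h2 : φ < Real.pi) :
    (gmE l φ * ∫ r in Ioi (0:ℝ), (Complex.exp (-gmP φ * r) - 1) * ((r ^ (l - 2) : ℝ) : ℂ)).im / Real.pi
      = 1 / Real.Gamma (2 - l) := by
  have hJ := gm_J (a := 1 - l) (by linarith) (by linarith) (gmP_re h1 h2)
  rw [show -(1 - l) - 1 = l - 2 by ring, show 1 - (1 - l) = l by ring] at hJ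
  rw [hJ, gmP, gm_cis_cpow (by linarith) (by linarith), gmE]
  have : Complex.exp (((φ * (l - 1) : ℝ) : ℂ) * Complex.I) *
      (-((Real.Gamma l / (1 - l) : ℝ) : ℂ) * Complex.exp (((φ - Real.pi : ℝ) : ℂ) * ((1 - l : ℝ) : ℂ) * Complex.I))
      = ((-(Real.Gamma l / (1 - l)) : ℝ) : ℂ) * Complex.exp (((-(Real.pi * (1 - l)) : ℝ) : ℂ) * Complex.I) := by
    rw [mul_left_comm, ← Complex.exp_add]
    push_cast
    congr 2
    ring
  rw [this, Complex.im_ofReal_mul, Complex.exp_ofReal_mul_I_im, Real.sin_neg]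
  have h3 := gm_reflect (s := l) (by linarith)
  have h4 : Real.Gamma (2 - l) = (1 - l) * Real.Gamma (1 - l) := by
    rw [show 2 - l = (1 - l) + 1 by ring, Real.Gamma_add_one (by linarith)]
  have h5 : Real.sin (Real.pi * (1 - l)) = Real.sin (Real.pi * l) := by
    rw [show Real.pi * (1 - l) = Real.pi - Real.pi * l by ring, Real.sin_pi_sub]
  have h6 : (1 - l) ≠ 0 := by linarith
  rw [h4, h5, one_div, mul_inv, ← one_div (Real.Gamma _), ← h3]
  field_simp

lemma gm_termn {l φ : ℝ} (hl : 1/2 < l) (h1 : Real.pi / 2 < φ) (h2 : φ < Real.pi)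
    (n : ℕ) (hn : 1 ≤ n) :
    (gmE l φ * (gmQ l φ ^ n * ∫ r in Ioi (0:ℝ), Complex.exp (-gmP φ * r) * ((r ^ (((n:ℝ)+1) * l - 2) : ℝ) : ℂ))).im / Real.pi
      = 1 / Real.Gamma (2 - ((n:ℝ)+1) * l) := by
  have hn' : (1:ℝ) ≤ n := by exact_mod_cast hn
  obtain ⟨s, hs⟩ : ∃ s, s = ((n:ℝ)+1) * l - 1 := ⟨_, rfl⟩
  have hs0 : 0 < s := by rw [hs]; nlinarith
  have hJ := gm_gammaC hs0 (gmP_re h1 h2)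
  rw [show ((n:ℝ)+1) * l - 2 = s - 1 by rw [hs]; ring, hJ, show 2 - ((n:ℝ)+1) * l = 1 - s by rw [hs]; ring,
    gmP, gm_cis_cpow (by linarith) (by linarith), gmE, gmQ, ← Complex.exp_nat_mul]
  have : ∀ A B C D : ℂ, A * (B * (C * D)) = C * (A * B * D) := by intros; ring
  rw [this, ← Complex.exp_add, ← Complex.exp_add]
  have : (((φ * (l - 1) : ℝ) : ℂ) * Complex.I + (n:ℂ) * (((l * φ : ℝ) : ℂ) * Complex.I) +
    ((φ - Real.pi : ℝ) : ℂ) * (-(s:ℂ)) * Complex.I) = ((Real.pi * s : ℝ) : ℂ) * Complex.I := by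
    rw [hs]; push_cast; ring
  rw [this, Complex.im_ofReal_mul, Complex.exp_ofReal_mul_I_im]
  exact gm_reflect hs0

lemma gm_term3 {l φ : ℝ} (hl : 1/2 < l) (hl1 : l < 1) (h1 : Real.pi / 2 < φ) (h2 : φ < Real.pi)
    (h3 : l * φ < Real.pi / 2) {z : ℝ} (hz : 0 ≤ z) :
    (gmE l φ * ∫ r in Ioi (0:ℝ), (Complex.exp (-(z * gmQ l φ) * ((r ^ l : ℝ) : ℂ)) - 1) * ((r ^ (l - 2) : ℝ) : ℂ)).im = 0 := by
  rcases hz.eq_or_lt with rfl | hz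
  · simp
  have hl0 : 0 < l := by linarith
  have hφ0 : 0 < φ := by linarith [Real.pi_pos]
  have hq := gmQ_re (mul_pos hl0 hφ0) h3
  have hzq : 0 < ((z:ℂ) * gmQ l φ).re := by rw [Complex.re_ofReal_mul]; positivity
  have ha0 : 0 < 1 / l - 1 := by rw [sub_pos, lt_div_iff₀ hl0]; linarith
  have ha1 : 1 / l - 1 < 1 := by rw [sub_lt_iff_lt_add, div_lt_iff₀ hl0]; linarith
  have hJ := gm_J ha0 ha1 hzq
  rw [← integral_comp_rpow_Ioi_of_pos hl0] at hJ
  have hcongr : ∫ r in Ioi (0:ℝ), (l * r ^ (l - 1)) • ((Complex.exp (-(z * gmQ l φ) * ((r ^ l : ℝ) : ℂ)) - 1) * (((r ^ l) ^ (-(1 / l - 1) - 1) : ℝ) : ℂ))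
      = (l:ℂ) * ∫ r in Ioi (0:ℝ), (Complex.exp (-(z * gmQ l φ) * ((r ^ l : ℝ) : ℂ)) - 1) * ((r ^ (l - 2) : ℝ) : ℂ) := by
    rw [← integral_const_mul]
    refine setIntegral_congr_fun measurableSet_Ioi fun r hr => ?_
    have hr0 : (0:ℝ) < r := hr
    have h5 : r ^ (l - 2) = r ^ (l - 1) * (r ^ l) ^ (-(1 / l - 1) - 1) := by
      rw [← Real.rpow_mul hr0.le, ← Real.rpow_add hr0]
      congr 1; field_simp; ring
    simp only [Complex.real_smul]
    rw [h5]; push_cast; ring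
  rw [hcongr] at hJ
  have hlC : (l:ℂ) ≠ 0 := by exact_mod_cast hl0.ne'
  have hJ2 : (∫ r in Ioi (0:ℝ), (Complex.exp (-(z * gmQ l φ) * ((r ^ l : ℝ) : ℂ)) - 1) * ((r ^ (l - 2) : ℝ) : ℂ))
     = (1 / l) * (-((Real.Gamma (1-(1 / l - 1)) / (1 / l - 1) : ℝ) : ℂ) * (z * gmQ l φ) ^ ((1 / l - 1 : ℝ):ℂ)) := by
    rw [← hJ]; field_simp
  have hcp : ((z:ℂ) * gmQ l φ) ^ ((1 / l - 1 : ℝ):ℂ) = ((z ^ (1/l - 1) : ℝ) : ℂ) * Complex.exp (((φ * (1 - l) : ℝ):ℂ) * Complex.I) := by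
    have hq0 : gmQ l φ ≠ 0 := Complex.exp_ne_zero _
    have hz0 : (z:ℂ) ≠ 0 := by exact_mod_cast hz.ne'
    have hlog : Complex.log (gmQ l φ) = ((l * φ : ℝ) : ℂ) * Complex.I := by
      rw [gmQ, Complex.log_exp]
      · rw [Complex.im_ofReal_mul, Complex.I_im, mul_one]; linarith [Real.pi_pos, mul_pos hl0 hφ0]
      · rw [Complex.im_ofReal_mul, Complex.I_im, mul_one]; linarith [Real.pi_pos]
    rw [Complex.cpow_def_of_ne_zero (mul_ne_zero hz0 hq0), Complex.log_ofReal_mul hz hq0, hlog,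
      Real.rpow_def_of_pos hz, Complex.ofReal_exp, ← Complex.exp_add]
    congr 1
    push_cast; field_simp
  rw [hJ2, hcp, gmE]
  have : ∀ A B C D E : ℂ, A * (B * (C * (D * E))) = B * (C * D) * (A * E) := by intros; ring
  rw [this, ← Complex.exp_add]
  have h7 : ((φ * (l - 1) : ℝ):ℂ) * Complex.I + ((φ * (1 - l) : ℝ):ℂ) * Complex.I = 0 := by
    push_cast; ring
  rw [h7, Complex.exp_zero, mul_one]
  norm_cast

lemma gm_young {l c z : ℝ} (hl0 : 0 < l) (hl1 : l < 1) (hc : 0 < c) (hz : 0 ≤ z) :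
    ∃ K : ℝ, ∀ r : ℝ, 0 < r → z * r ^ l ≤ c * r + K := by
  have ht : Tendsto (fun r : ℝ => r ^ (-(1 - l))) atTop (𝓝 0) := tendsto_rpow_neg_atTop (by linarith)
  have hev : ∀ᶠ r : ℝ in atTop, z * r ^ (-(1 - l)) < c := by
    have := ht.const_mul z
    rw [mul_zero] at this
    exact this.eventually_lt_const hc
  obtain ⟨R, hR⟩ := eventually_atTop.1 hev
  refine ⟨z * (max R 1) ^ l, fun r hr => ?_⟩
  by_cases h : R ≤ r
  · have h1 := hR r h
    have h2 : r ^ l = r * r ^ (-(1 - l)) := by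
      nth_rewrite 2 [← Real.rpow_one r]
      rw [← Real.rpow_add hr]; congr 1; ring
    have h3 : 0 ≤ z * (max R 1) ^ l := by positivity
    rw [h2]
    nlinarith
  · push Not at h
    have h3 : r ^ l ≤ (max R 1) ^ l := Real.rpow_le_rpow hr.le (h.le.trans (le_max_left _ _)) hl0.le
    nlinarith [mul_le_mul_of_nonneg_left h3 hz, mul_pos hc hr]

lemma gm_exp_tail {𝕂 : Type*} [RCLike 𝕂] (x : 𝕂) :
    HasSum (fun n : ℕ => x ^ (n+1) / ((n+1).factorial : 𝕂)) (NormedSpace.exp x - 1) := by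
  have h := NormedSpace.expSeries_div_hasSum_exp x
  have h2 := (hasSum_nat_add_iff' 1).2 h
  simpa using h2

lemma gm_hasSum {l φ : ℝ} (hl : 1/2 < l) (hl1 : l < 1) (h1 : Real.pi / 2 < φ) (h2 : φ < Real.pi)
    {z : ℝ} (hz : 0 ≤ z) :
    IntegrableOn (fun r : ℝ => Complex.exp (-gmP φ * r) *
      (Complex.exp (-(z * gmQ l φ) * ((r ^ l : ℝ) : ℂ)) - 1) * ((r ^ (l - 2) : ℝ) : ℂ)) (Ioi 0) ∧
    HasSum (fun n : ℕ => ∫ r in Ioi (0:ℝ), Complex.exp (-gmP φ * r) *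
      ((-(z * gmQ l φ) * ((r ^ l : ℝ) : ℂ)) ^ (n+1) / ((n+1).factorial : ℂ)) * ((r ^ (l - 2) : ℝ) : ℂ))
      (∫ r in Ioi (0:ℝ), Complex.exp (-gmP φ * r) *
      (Complex.exp (-(z * gmQ l φ) * ((r ^ l : ℝ) : ℂ)) - 1) * ((r ^ (l - 2) : ℝ) : ℂ)) := by
  have hc := gmP_re h1 h2
  set c := (gmP φ).re with hcdef
  have hl0 : 0 < l := by linarith
  obtain ⟨K, hK⟩ := gm_young (l := l) (c := c / 2) (z := z) hl0 hl1 (by linarith) hz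
  set bound : ℕ → ℝ → ℝ := fun n r => Real.exp (-c * r) * ((z * r ^ l) ^ (n+1) / ((n+1).factorial : ℝ)) * r ^ (l - 2)
  have hbs : ∀ r : ℝ, HasSum (fun n => bound n r) (Real.exp (-c * r) * (Real.exp (z * r ^ l) - 1) * r ^ (l - 2)) := by
    intro r
    have := gm_exp_tail (𝕂 := ℝ) (z * r ^ l)
    rw [← Real.exp_eq_exp_ℝ] at this
    exact (this.mul_left _).mul_right _
  have hnz : ∀ r : ℝ, 0 < r → ‖-(z * gmQ l φ) * ((r ^ l : ℝ) : ℂ)‖ = z * r ^ l := by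
    intro r hr
    rw [norm_mul, norm_neg, norm_mul, gmQ_norm, Complex.norm_real, Complex.norm_real, mul_one,
      Real.norm_of_nonneg hz, Real.norm_of_nonneg (by positivity)]
  have hbn : ∀ n : ℕ, ∀ r : ℝ, 0 < r → ‖Complex.exp (-gmP φ * r) *
      ((-(z * gmQ l φ) * ((r ^ l : ℝ) : ℂ)) ^ (n+1) / ((n+1).factorial : ℂ)) * ((r ^ (l - 2) : ℝ) : ℂ)‖ = bound n r := by
    intro n r hr
    rw [norm_mul, norm_mul, norm_div, norm_pow, hnz r hr, gm_norm_cexp, Complex.norm_real,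
      Real.norm_of_nonneg (by positivity), Complex.norm_natCast]
  have hlim : ∀ r : ℝ, HasSum (fun n : ℕ => Complex.exp (-gmP φ * r) *
      ((-(z * gmQ l φ) * ((r ^ l : ℝ) : ℂ)) ^ (n+1) / ((n+1).factorial : ℂ)) * ((r ^ (l - 2) : ℝ) : ℂ))
      (Complex.exp (-gmP φ * r) *
      (Complex.exp (-(z * gmQ l φ) * ((r ^ l : ℝ) : ℂ)) - 1) * ((r ^ (l - 2) : ℝ) : ℂ)) := by
    intro r
    have := gm_exp_tail (𝕂 := ℂ) (-(z * gmQ l φ) * ((r ^ l : ℝ) : ℂ))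
    rw [← Complex.exp_eq_exp_ℂ] at this
    exact (this.mul_left _).mul_right _
  have hbint : IntegrableOn (fun r => ∑' n, bound n r) (Ioi 0) := by
    have h0 : IntegrableOn (fun r : ℝ => (z * Real.exp K) * (r ^ (2 * l - 2) * Real.exp (-(c/2) * r))) (Ioi 0) :=
      (gm_int_rpow_exp (by linarith) (by linarith)).const_mul _
    simp_rw [fun r => (hbs r).tsum_eq]
    refine h0.mono' (by fun_prop) ?_
    filter_upwards [ae_restrict_mem measurableSet_Ioi] with r hr
    have hr0 : (0:ℝ) < r := hr
    have hx0 : 0 ≤ z * r ^ l := by positivity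
    have e1 : 0 ≤ Real.exp (z * r ^ l) - 1 := by linarith [Real.add_one_le_exp (z * r ^ l)]
    have e2 : Real.exp (z * r ^ l) - 1 ≤ (z * r ^ l) * Real.exp (z * r ^ l) := by
      have := Real.add_one_le_exp (-(z * r ^ l))
      have h5 := mul_le_mul_of_nonneg_right this (Real.exp_pos (z * r ^ l)).le
      rw [← Real.exp_add, neg_add_cancel, Real.exp_zero] at h5
      linarith
    rw [Real.norm_of_nonneg (by positivity)]
    have e3 : Real.exp (-c * r) * Real.exp (z * r ^ l) ≤ Real.exp K * Real.exp (-(c/2) * r) := by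
      rw [← Real.exp_add, ← Real.exp_add]
      apply Real.exp_le_exp.2
      have := hK r hr0; linarith
    have e4 : r ^ (2 * l - 2) = r ^ l * r ^ (l - 2) := by
      rw [← Real.rpow_add hr0]; congr 1; ring
    calc _ ≤ Real.exp (-c * r) * ((z * r ^ l) * Real.exp (z * r ^ l)) * r ^ (l-2) := by gcongr
      _ = (z * r ^ l * r ^ (l-2)) * (Real.exp (-c * r) * Real.exp (z * r ^ l)) := by ring
      _ ≤ (z * r ^ l * r ^ (l-2)) * (Real.exp K * Real.exp (-(c/2) * r)) := by gcongr
      _ = _ := by rw [e4]; ring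
  refine ⟨?_, ?_⟩
  · refine hbint.mono' (by fun_prop) ?_
    filter_upwards [ae_restrict_mem measurableSet_Ioi] with r hr
    rw [← (hlim r).tsum_eq]
    refine (norm_tsum_le_tsum_norm ?_).trans ?_
    · simp_rw [fun n => hbn n r hr]; exact (hbs r).summable
    · simp_rw [fun n => hbn n r hr]; exact le_rfl
  · refine hasSum_integral_of_dominated_convergence bound (fun n => by fun_prop) ?_ ?_ hbint ?_
    · intro n
      filter_upwards [ae_restrict_mem measurableSet_Ioi] with r hr
      exact (hbn n r hr).le
    · exact Eventually.of_forall fun r => (hbs r).summable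
    · exact Eventually.of_forall fun r => hlim r

/-- the integrand of the representation -/
noncomputable def gmF (l φ z r : ℝ) : ℂ :=
  (Complex.exp (-gmP φ * r) - 1) * Complex.exp (-(z * gmQ l φ) * ((r ^ l : ℝ) : ℂ)) * ((r ^ (l - 2) : ℝ) : ℂ)

lemma gmF_norm {l φ z r : ℝ} (hr : 0 < r) : ‖gmF l φ z r‖ =
    ‖Complex.exp (-gmP φ * r) - 1‖ * Real.exp (-(z * (gmQ l φ).re) * r ^ l) * r ^ (l - 2) := by
  rw [gmF, norm_mul, norm_mul, gm_norm_cexp, Complex.norm_real, Real.norm_of_nonneg (by positivity),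
    Complex.re_ofReal_mul]

lemma gmF_bound1 {l φ z r : ℝ} (hl : 1/2 < l) (h1 : Real.pi / 2 < φ) 
    (h3 : l * φ < Real.pi / 2) (hz : 0 ≤ z) (hr : 0 < r) : ‖gmF l φ z r‖ ≤
    ‖(Complex.exp (-gmP φ * r) - 1) * ((r ^ (l - 2) : ℝ) : ℂ)‖ := by
  have hq := gmQ_re (mul_pos (by linarith) (by linarith [Real.pi_pos])) h3
  rw [gmF_norm hr, norm_mul, Complex.norm_real, Real.norm_of_nonneg (by positivity)]
  have : Real.exp (-(z * (gmQ l φ).re) * r ^ l) ≤ 1 := by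
    apply Real.exp_le_one_iff.2
    have : 0 ≤ z * (gmQ l φ).re * r ^ l := by positivity
    linarith
  have h5 := norm_nonneg (Complex.exp (-gmP φ * r) - 1)
  gcongr
  nlinarith

lemma gmF_bound2 {l φ z r : ℝ} (h1 : Real.pi / 2 < φ) (h2 : φ < Real.pi) (hr : 0 < r) :
    ‖gmF l φ z r‖ ≤ 2 * (r ^ (l - 1) * Real.exp (-(z * (gmQ l φ).re) * r ^ l)) := by
  rw [gmF_norm hr]
  have h := (gm_exp_sub_one (gmP_re h1 h2).le hr.le).2
  rw [gmP_norm] at h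
  have e4 : r ^ (l - 1) = r * r ^ (l - 2) := by
    nth_rewrite 2 [← Real.rpow_one r]
    rw [← Real.rpow_add hr]; congr 1; ring
  calc _ ≤ (2 * 1 * r) * Real.exp (-(z * (gmQ l φ).re) * r ^ l) * r ^ (l - 2) := by gcongr
    _ = _ := by rw [e4]; ring

lemma gm_int_T2 {l φ : ℝ} (hl : 1/2 < l) (hl1 : l < 1) (h1 : Real.pi / 2 < φ) (h2 : φ < Real.pi) :
    IntegrableOn (fun r : ℝ => (Complex.exp (-gmP φ * r) - 1) * ((r ^ (l - 2) : ℝ) : ℂ)) (Ioi 0) := by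
  have := gm_int_J (a := 1 - l) (by linarith) (by linarith) (gmP_re h1 h2).le
  rwa [show -(1 - l) - 1 = l - 2 by ring] at this

lemma gmF_meas (l φ z : ℝ) : Measurable (gmF l φ z) := by
  unfold gmF; fun_prop

lemma gmF_int {l φ z : ℝ} (hl : 1/2 < l) (hl1 : l < 1) (h1 : Real.pi / 2 < φ) (h2 : φ < Real.pi)
    (h3 : l * φ < Real.pi / 2) (hz : 0 ≤ z) : IntegrableOn (gmF l φ z) (Ioi 0) := by
  refine (gm_int_T2 hl hl1 h1 h2).norm.mono' (gmF_meas _ _ _).aestronglyMeasurable ?_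
  filter_upwards [ae_restrict_mem measurableSet_Ioi] with r hr
  exact gmF_bound1 hl h1 h3 hz hr

lemma gm_repr {l φ z : ℝ} (hl : 1/2 < l) (hl1 : l < 1) (h1 : Real.pi / 2 < φ) (h2 : φ < Real.pi)
    (h3 : l * φ < Real.pi / 2) (hz : 0 ≤ z) :
    mainardiR l 2 z = (gmE l φ * ∫ r in Ioi (0:ℝ), gmF l φ z r).im / Real.pi := by
  obtain ⟨hT1, hS⟩ := gm_hasSum hl hl1 h1 h2 hz
  have hT2 := gm_int_T2 hl hl1 h1 h2
  have hN := gmF_int hl hl1 h1 h2 h3 hz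
  -- terms
  have hterm : ∀ n : ℕ, (gmE l φ * ∫ r in Ioi (0:ℝ), Complex.exp (-gmP φ * r) *
      ((-(z * gmQ l φ) * ((r ^ l : ℝ) : ℂ)) ^ (n+1) / ((n+1).factorial : ℂ)) * ((r ^ (l - 2) : ℝ) : ℂ)).im / Real.pi
      = (-z) ^ (n+1) / (((n+1).factorial : ℝ) * Real.Gamma (2 - (((n+1 : ℕ) : ℝ) + 1) * l)) := by
    intro n
    have hA := gm_termn hl h1 h2 (n+1) (by omega)
    have hc : ∫ r in Ioi (0:ℝ), Complex.exp (-gmP φ * r) *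
      ((-(z * gmQ l φ) * ((r ^ l : ℝ) : ℂ)) ^ (n+1) / ((n+1).factorial : ℂ)) * ((r ^ (l - 2) : ℝ) : ℂ)
      = (((-z) ^ (n+1) / ((n+1).factorial : ℝ) : ℝ) : ℂ) * (gmQ l φ ^ (n+1) * ∫ r in Ioi (0:ℝ), Complex.exp (-gmP φ * r) * ((r ^ ((((n+1:ℕ):ℝ)+1) * l - 2) : ℝ) : ℂ)) := by
      rw [← integral_const_mul, ← integral_const_mul]
      refine setIntegral_congr_fun measurableSet_Ioi fun r hr => ?_
      have hr0 : (0:ℝ) < r := hr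
      have : r ^ ((((n+1:ℕ):ℝ)+1) * l - 2) = (r ^ l) ^ (n+1) * r ^ (l - 2) := by
        rw [← Real.rpow_natCast, ← Real.rpow_mul hr0.le, ← Real.rpow_add hr0]
        congr 1; push_cast; ring
      simp only [this]
      have hpw : (-(z * gmQ l φ) * ((r ^ l : ℝ) : ℂ)) ^ (n+1) = (-(z:ℂ)) ^ (n+1) * gmQ l φ ^ (n+1) * ((r ^ l : ℝ) : ℂ) ^ (n+1) := by
        rw [← mul_pow, ← mul_pow]; congr 1; ring
      rw [hpw]
      push_cast
      ring
    rw [hc, mul_left_comm, Complex.im_ofReal_mul, mul_div_assoc, hA]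
    rw [div_mul_div_comm, mul_one]
  have hS2 : HasSum (fun n : ℕ => (-z) ^ (n+1) / (((n+1).factorial : ℝ) * Real.Gamma (2 - (((n+1 : ℕ) : ℝ) + 1) * l)))
      ((gmE l φ * ∫ r in Ioi (0:ℝ), Complex.exp (-gmP φ * r) *
      (Complex.exp (-(z * gmQ l φ) * ((r ^ l : ℝ) : ℂ)) - 1) * ((r ^ (l - 2) : ℝ) : ℂ)).im / Real.pi) := by
    have := (Complex.hasSum_im (hS.mul_left (gmE l φ))).div_const Real.pi
    simpa only [hterm] using this
  have hS3 := (hasSum_nat_add_iff (f := fun n : ℕ => (-z) ^ n / ((n.factorial : ℝ) * Real.Gamma (2 - ((n : ℝ) + 1) * l))) 1).1 hS2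
  rw [mainardiR, hS3.tsum_eq]
  have h0 := gm_term0 hl hl1 h1 h2
  have h30 := gm_term3 hl hl1 h1 h2 h3 hz
  have hsplit : ∫ r in Ioi (0:ℝ), (Complex.exp (-(z * gmQ l φ) * ((r ^ l : ℝ) : ℂ)) - 1) * ((r ^ (l - 2) : ℝ) : ℂ)
      = (∫ r in Ioi (0:ℝ), Complex.exp (-gmP φ * r) *
      (Complex.exp (-(z * gmQ l φ) * ((r ^ l : ℝ) : ℂ)) - 1) * ((r ^ (l - 2) : ℝ) : ℂ))
      + (∫ r in Ioi (0:ℝ), (Complex.exp (-gmP φ * r) - 1) * ((r ^ (l - 2) : ℝ) : ℂ)) - ∫ r in Ioi (0:ℝ), gmF l φ z r := by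
    rw [← integral_add' hT1 hT2, ← integral_sub (hT1.add hT2) hN]
    refine integral_congr_ae (Eventually.of_forall fun r => ?_)
    simp only [gmF, Pi.add_apply]; ring
  rw [hsplit, mul_sub, mul_add, Complex.sub_im, Complex.add_im] at h30
  have h5 : (gmE l φ * ∫ r in Ioi (0:ℝ), gmF l φ z r).im = _ := (sub_eq_zero.1 h30).symm
  rw [h5, add_div, h0]
  simp

lemma gm_exists_phi {l : ℝ} (hl : 1/2 < l) (hl1 : l < 1) :
    ∃ φ : ℝ, Real.pi / 2 < φ ∧ φ < Real.pi ∧ l * φ < Real.pi / 2 := by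
  have hpi := Real.pi_pos
  refine ⟨Real.pi / (1 + l), ?_, ?_, ?_⟩
  · rw [div_lt_div_iff₀ (by norm_num) (by linarith)]; nlinarith
  · rw [div_lt_iff₀ (by linarith)]; nlinarith
  · rw [← mul_div_assoc, div_lt_div_iff₀ (by linarith) (by norm_num)]; nlinarith

lemma gm_continuous {l : ℝ} (hl : 1/2 < l) (hl1 : l < 1) :
    Continuous (fun x : ℝ => mainardiR l 2 |x|) := by
  obtain ⟨φ, h1, h2, h3⟩ := gm_exists_phi hl hl1
  have : (fun x : ℝ => mainardiR l 2 |x|) = fun x : ℝ => (gmE l φ * ∫ r in Ioi (0:ℝ), gmF l φ |x| r).im / Real.pi := by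
    funext x; exact gm_repr hl hl1 h1 h2 h3 (abs_nonneg x)
  rw [this]
  have hc : Continuous (fun x : ℝ => ∫ r in Ioi (0:ℝ), gmF l φ |x| r) := by
    refine continuous_of_dominated (fun x => (gmF_meas _ _ _).aestronglyMeasurable) ?_ (gm_int_T2 hl hl1 h1 h2).norm ?_
    · intro x
      filter_upwards [ae_restrict_mem measurableSet_Ioi] with r hr
      exact gmF_bound1 hl h1 h3 (abs_nonneg x) hr
    · refine Eventually.of_forall fun r => ?_
      unfold gmF
      fun_prop
  exact (Complex.continuous_im.comp (continuous_const.mul hc)).div_const _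

lemma gm_decay {l : ℝ} (hl : 1/2 < l) (hl1 : l < 1) :
    ∃ C : ℝ, 0 < C ∧ ∀ z : ℝ, 0 ≤ z → |mainardiR l 2 z| ≤ C / (1 + z) := by
  obtain ⟨φ, h1, h2, h3⟩ := gm_exists_phi hl hl1
  have hl0 : 0 < l := by linarith
  have hq := gmQ_re (mul_pos hl0 (by linarith [Real.pi_pos])) h3
  set c := (gmQ l φ).re
  set A := ∫ r in Ioi (0:ℝ), ‖(Complex.exp (-gmP φ * r) - 1) * ((r ^ (l - 2) : ℝ) : ℂ)‖
  have hA : 0 ≤ A := integral_nonneg fun r => norm_nonneg _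
  have hM : ∀ z : ℝ, 0 ≤ z → |mainardiR l 2 z| ≤ ∫ r in Ioi (0:ℝ), ‖gmF l φ z r‖ := by
    intro z hz
    rw [gm_repr hl hl1 h1 h2 h3 hz, abs_div, abs_of_pos Real.pi_pos]
    have e1 : |(gmE l φ * ∫ r in Ioi (0:ℝ), gmF l φ z r).im| ≤ ∫ r in Ioi (0:ℝ), ‖gmF l φ z r‖ := by
      refine (Complex.abs_im_le_norm _).trans ?_
      rw [norm_mul, gmE_norm, one_mul]
      exact norm_integral_le_integral_norm _
    refine (div_le_self (abs_nonneg _) ?_).trans e1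
    linarith [Real.pi_gt_three]
  have hb1 : ∀ z : ℝ, 0 ≤ z → |mainardiR l 2 z| ≤ A := by
    intro z hz
    refine (hM z hz).trans (setIntegral_mono_on (gmF_int hl hl1 h1 h2 h3 hz).norm (gm_int_T2 hl hl1 h1 h2).norm measurableSet_Ioi ?_)
    intro r hr
    exact gmF_bound1 hl h1 h3 hz hr
  have hb2 : ∀ z : ℝ, 0 < z → |mainardiR l 2 z| * z ≤ 2 / (l * c) := by
    intro z hz
    have hzc : 0 < z * c := mul_pos hz hq
    have hi := integrableOn_rpow_mul_exp_neg_mul_rpow (s := l - 1) (p := l) (b := z * c) (by linarith) hl0 hzc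
    have hv := integral_rpow_mul_exp_neg_mul_rpow (q := l - 1) (p := l) (b := z * c) hl0 (by linarith) hzc
    have e : |mainardiR l 2 z| ≤ 2 * ((z * c) ^ (-(l - 1 + 1) / l) * (1 / l) * Real.Gamma ((l - 1 + 1) / l)) := by
      rw [← hv, ← integral_const_mul]
      refine (hM z hz.le).trans (setIntegral_mono_on (gmF_int hl hl1 h1 h2 h3 hz.le).norm (hi.const_mul 2) measurableSet_Ioi ?_)
      intro r hr
      exact gmF_bound2 h1 h2 hr
    rw [show -(l - 1 + 1) / l = -1 by field_simp; ring, show (l - 1 + 1) / l = 1 by field_simp; ring, Real.Gamma_one, Real.rpow_neg_one] at e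
    calc _ ≤ _ := mul_le_mul_of_nonneg_right e hz.le
      _ = _ := by field_simp
  have hB : 0 < 2 / (l * c) := by positivity
  refine ⟨A + 2 / (l * c), by linarith, fun z hz => ?_⟩
  rw [le_div_iff₀ (by linarith), mul_add, mul_one]
  refine add_le_add (hb1 z hz) ?_
  rcases hz.eq_or_lt with rfl | hz
  · rw [mul_zero]; exact hB.le
  · exact hb2 z hz

lemma gm_green {β : ℝ} (hβ1 : 1 < β) (hβ2 : β < 2) (t x : ℝ) :
    greenGext β t x = if 0 < t then t ^ (1 - β / 2) / 2 * mainardiR (β / 2) 2 |x / t ^ (β / 2)| else 0 := by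
  have hc : ⌈β⌉₊ = 2 := by
    rw [Nat.ceil_eq_iff (by norm_num)]
    constructor
    · norm_num; exact hβ1
    · norm_num; exact hβ2.le
  unfold greenGext greenG
  split_ifs with h
  · rw [hc, abs_div, abs_of_pos (Real.rpow_pos_of_pos h _)]
    norm_num
  · rfl

lemma gm_green_meas {β : ℝ} (hβ1 : 1 < β) (hβ2 : β < 2) :
    Measurable (fun p : ℝ × ℝ => greenGext β p.1 p.2) := by
  have hm : Measurable (fun x : ℝ => mainardiR (β/2) 2 |x|) :=
    (gm_continuous (by linarith) (by linarith)).measurable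
  simp_rw [gm_green hβ1 hβ2]
  refine Measurable.ite (measurableSet_lt measurable_const measurable_fst) ?_ measurable_const
  refine Measurable.mul (by fun_prop) ?_
  exact hm.comp (by fun_prop : Measurable fun p : ℝ × ℝ => p.2 / p.1 ^ (β/2))

lemma gm_green_contAt {β : ℝ} (hβ1 : 1 < β) (hβ2 : β < 2) {t x : ℝ} (ht : t ≠ 0) :
    ContinuousAt (fun p : ℝ × ℝ => greenGext β p.1 p.2) (t, x) := by
  have hm : Continuous (fun x : ℝ => mainardiR (β/2) 2 |x|) :=
    (gm_continuous (by linarith) (by linarith))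
  rcases lt_or_gt_of_ne ht with h | h
  · have : (fun p : ℝ × ℝ => greenGext β p.1 p.2) =ᶠ[𝓝 (t, x)] fun _ => (0:ℝ) := by
      have : ∀ᶠ p : ℝ × ℝ in 𝓝 (t, x), p.1 < 0 := (continuous_fst.tendsto (t, x)).eventually_lt_const h
      filter_upwards [this] with p hp
      rw [gm_green hβ1 hβ2, if_neg (by linarith)]
    exact continuousAt_const.congr this.symm
  · have h2 : (fun p : ℝ × ℝ => greenGext β p.1 p.2) =ᶠ[𝓝 (t, x)]
        fun p => p.1 ^ (1 - β / 2) / 2 * mainardiR (β / 2) 2 |p.2 / p.1 ^ (β / 2)| := by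
      have : ∀ᶠ p : ℝ × ℝ in 𝓝 (t, x), 0 < p.1 := (continuous_fst.tendsto (t, x)).eventually_const_lt h
      filter_upwards [this] with p hp
      rw [gm_green hβ1 hβ2, if_pos hp]
    refine ContinuousAt.congr ?_ h2.symm
    have hp : ∀ a : ℝ, ContinuousAt (fun p : ℝ × ℝ => p.1 ^ a) (t, x) := fun a =>
      continuousAt_fst.rpow_const (Or.inl h.ne')
    refine ((hp _).div_const _).mul ?_
    have h3 : ContinuousAt (fun p : ℝ × ℝ => p.2 / p.1 ^ (β / 2)) (t, x) :=
      continuousAt_snd.div (hp _) (Real.rpow_pos_of_pos h _).ne'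
    exact ContinuousAt.comp (g := fun x : ℝ => mainardiR (β/2) 2 |x|) hm.continuousAt h3

lemma gm_green_bound {β : ℝ} (hβ1 : 1 < β) (hβ2 : β < 2) {T : ℝ} (hT : 1 ≤ T) :
    ∃ D : ℝ, 0 < D ∧ ∀ r z : ℝ, r ≤ T → |greenGext β r z| ≤ D / (1 + |z|) := by
  obtain ⟨C, hC, hM⟩ := gm_decay (l := β / 2) (by linarith) (by linarith)
  refine ⟨T * C, by positivity, fun r z hr => ?_⟩
  rw [gm_green hβ1 hβ2]
  have hz := abs_nonneg z
  split_ifs with h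
  · have hrp : 0 < r ^ (β/2) := Real.rpow_pos_of_pos h _
    have hTp : 0 < T ^ (β/2) := Real.rpow_pos_of_pos (by linarith) _
    have hT1 : 1 ≤ T ^ (β/2) := Real.one_le_rpow hT (by linarith)
    have h1 : r ^ (1 - β/2) ≤ T ^ (1 - β/2) := Real.rpow_le_rpow h.le hr (by linarith)
    have h2 : r ^ (β/2) ≤ T ^ (β/2) := Real.rpow_le_rpow h.le hr (by linarith)
    have h3 : T ^ (1 - β/2) * T ^ (β/2) = T := by
      rw [← Real.rpow_add (by linarith)]; simp
    have h4 := hM |z / r ^ (β/2)| (abs_nonneg _)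
    have h5 : (1 + |z|) / T ^ (β/2) ≤ 1 + |z / r ^ (β/2)| := by
      rw [abs_div, abs_of_pos hrp, add_div]
      apply add_le_add
      · rw [div_le_one hTp]; exact hT1
      · gcongr
    have h6 : C / (1 + |z / r ^ (β/2)|) ≤ C / ((1 + |z|) / T ^ (β/2)) := by gcongr
    have h0 : 0 ≤ r ^ (1 - β/2) := Real.rpow_nonneg h.le _
    rw [abs_mul, abs_of_nonneg (by positivity : 0 ≤ r ^ (1 - β/2) / 2)]
    calc _ ≤ T ^ (1 - β/2) * (C / ((1 + |z|) / T ^ (β/2))) := by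
          apply mul_le_mul _ (h4.trans h6) (abs_nonneg _) (by positivity)
          linarith
      _ = (T ^ (1 - β/2) * T ^ (β/2)) * C / (1 + |z|) := by field_simp
      _ = _ := by rw [h3]
  · rw [abs_zero]; positivity

end aux

/-- for `β ∈ (1,2)` and fixed `(t,x)` with `t > 0`, the map
`(t′,x′) ↦ ∫_0^∞ ∫_ℝ (G_β(t′−s, x′−y) − G_β(t−s, x−y))² dy ds` (with the convention
`G_β(r,·) = 0` for `r ≤ 0`) tends to `0` as `(t′,x′) → (t,x)` in `(0,∞) × ℝ`. -/
theorem greenG_L2_continuity (β : ℝ) (hβ1 : 1 < β) (hβ2 : β < 2)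
    (t x : ℝ) (ht : 0 < t) :
    Tendsto
      (fun p : ℝ × ℝ =>
        ∫ s in Set.Ioi (0 : ℝ), ∫ y : ℝ,
          (greenGext β (p.1 - s) (p.2 - y) - greenGext β (t - s) (x - y)) ^ 2)
      (nhdsWithin (t, x) (Set.Ioi (0 : ℝ) ×ˢ (Set.univ : Set ℝ)))
      (nhds 0) := by
  refine Tendsto.mono_left ?_ nhdsWithin_le_nhds
  obtain ⟨D, hD, hb⟩ := gm_green_bound hβ1 hβ2 (T := t + 1) (by linarith)
  have hmeas := gm_green_meas hβ1 hβ2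
  -- joint measurability
  have hjm : ∀ p : ℝ × ℝ, Measurable (fun q : ℝ × ℝ =>
      (greenGext β (p.1 - q.1) (p.2 - q.2) - greenGext β (t - q.1) (x - q.2)) ^ 2) := by
    intro p
    have e1 : Measurable (fun q : ℝ × ℝ => greenGext β (p.1 - q.1) (p.2 - q.2)) :=
      hmeas.comp (by fun_prop : Measurable fun q : ℝ × ℝ => (p.1 - q.1, p.2 - q.2))
    have e2 : Measurable (fun q : ℝ × ℝ => greenGext β (t - q.1) (x - q.2)) :=
      hmeas.comp (by fun_prop : Measurable fun q : ℝ × ℝ => (t - q.1, x - q.2))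
    exact (e1.sub e2).pow_const 2
  -- neighbourhood
  have hnb : ∀ᶠ p : ℝ × ℝ in 𝓝 (t, x), p.1 < t + 1 ∧ |x - p.2| < 1 := by
    have a1 : ∀ᶠ p : ℝ × ℝ in 𝓝 (t, x), p.1 < t + 1 :=
      (continuous_fst.tendsto (t, x)).eventually_lt_const (by simp)
    have a2 : ∀ᶠ p : ℝ × ℝ in 𝓝 (t, x), |x - p.2| < 1 := by
      have : Continuous fun p : ℝ × ℝ => |x - p.2| := by fun_prop
      exact (this.tendsto (t, x)).eventually_lt_const (by simp)
    exact a1.and a2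
  -- pointwise bound
  have hpt : ∀ p : ℝ × ℝ, p.1 < t + 1 → |x - p.2| < 1 → ∀ s y : ℝ, 0 < s →
      (greenGext β (p.1 - s) (p.2 - y) - greenGext β (t - s) (x - y)) ^ 2 ≤
        (3 * D) ^ 2 * (1 + (x - y) ^ 2)⁻¹ := by
    intro p h1 h2 s y hs
    have b1 := hb (p.1 - s) (p.2 - y) (by linarith)
    have b2 := hb (t - s) (x - y) (by linarith)
    have hxy := abs_nonneg (x - y)
    have hpy := abs_nonneg (p.2 - y)
    have tri : |x - y| ≤ |x - p.2| + |p.2 - y| := abs_sub_le _ _ _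
    have b3 : D / (1 + |p.2 - y|) ≤ 2 * D / (1 + |x - y|) := by
      rw [div_le_div_iff₀ (by linarith) (by linarith)]
      nlinarith
    have b4 : |greenGext β (p.1 - s) (p.2 - y) - greenGext β (t - s) (x - y)| ≤ 3 * D / (1 + |x - y|) := by
      refine (abs_sub _ _).trans ?_
      have : 3 * D / (1 + |x - y|) = 2 * D / (1 + |x - y|) + D / (1 + |x - y|) := by ring
      rw [this]; linarith
    rw [← sq_abs]
    calc _ ≤ (3 * D / (1 + |x - y|)) ^ 2 := by gcongr
      _ = (3 * D) ^ 2 * ((1 + |x - y|) ^ 2)⁻¹ := by rw [div_pow]; rfl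
      _ ≤ _ := by
        gcongr
        rw [← sq_abs (x - y)]; nlinarith
  have hgi : Integrable (fun y : ℝ => (3 * D) ^ 2 * (1 + (x - y) ^ 2)⁻¹) :=
    (integrable_inv_one_add_sq.comp_sub_left x).const_mul _
  set B := ∫ y : ℝ, (3 * D) ^ 2 * (1 + (x - y) ^ 2)⁻¹
  have hB : 0 ≤ B := integral_nonneg fun y => by positivity
  have hzero : ∫ s in Set.Ioi (0:ℝ), (0:ℝ) = 0 := by simp
  suffices hmain : Tendsto (fun p : ℝ × ℝ => ∫ s in Set.Ioi (0 : ℝ), ∫ y : ℝ,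
      (greenGext β (p.1 - s) (p.2 - y) - greenGext β (t - s) (x - y)) ^ 2) (𝓝 (t, x))
      (𝓝 (∫ s in Set.Ioi (0:ℝ), (0:ℝ))) by
    rw [hzero] at hmain
    exact hmain
  refine tendsto_integral_filter_of_dominated_convergence ((Set.Iio (t+1)).indicator fun _ => B) ?_ ?_ ?_ ?_
  · refine Eventually.of_forall fun p => ?_
    exact ((hjm p).stronglyMeasurable.integral_prod_right' (ν := volume)).aestronglyMeasurable
  · filter_upwards [hnb] with p hp
    filter_upwards [ae_restrict_mem measurableSet_Ioi] with s hs
    have hs0 : (0:ℝ) < s := hs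
    rw [Real.norm_of_nonneg (integral_nonneg fun y => by positivity)]
    by_cases hsT : s < t + 1
    · rw [Set.indicator_of_mem (by exact hsT)]
      refine integral_mono_of_nonneg (Eventually.of_forall fun y => by positivity) hgi ?_
      exact Eventually.of_forall fun y => hpt p hp.1 hp.2 s y hs0
    · rw [Set.indicator_of_notMem (by exact hsT)]
      push Not at hsT
      have : ∀ y : ℝ, (greenGext β (p.1 - s) (p.2 - y) - greenGext β (t - s) (x - y)) ^ 2 = 0 := by
        intro y
        rw [greenGext, greenGext, if_neg (by linarith [hp.1]), if_neg (by linarith)]; simp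
      simp [this]
  · rw [integrable_indicator_iff measurableSet_Iio]
    refine integrableOn_const ?_ 
    rw [Measure.restrict_apply measurableSet_Iio, Set.Iio_inter_Ioi]
    simp
  · have hne : ∀ᵐ s : ℝ ∂(volume.restrict (Set.Ioi (0:ℝ))), s ≠ t :=
      ae_restrict_of_ae (Measure.ae_ne volume t)
    filter_upwards [ae_restrict_mem measurableSet_Ioi, hne] with s hs hst
    have hz2 : ∫ y : ℝ, (0:ℝ) = 0 := by simp
    have key : Tendsto (fun p : ℝ × ℝ => ∫ y : ℝ, (greenGext β (p.1 - s) (p.2 - y) -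
        greenGext β (t - s) (x - y)) ^ 2) (𝓝 (t, x)) (𝓝 (∫ y : ℝ, (0:ℝ))) := by
      refine tendsto_integral_filter_of_dominated_convergence (fun y : ℝ => (3 * D) ^ 2 * (1 + (x - y) ^ 2)⁻¹) ?_ ?_ hgi ?_
      · exact Eventually.of_forall fun p =>
          ((hjm p).comp (measurable_prodMk_left (x := s))).aestronglyMeasurable
      · filter_upwards [hnb] with p hp
        refine Eventually.of_forall fun y => ?_
        rw [Real.norm_of_nonneg (by positivity)]
        exact hpt p hp.1 hp.2 s y hs
      · refine Eventually.of_forall fun y => ?_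
        have hc := gm_green_contAt hβ1 hβ2 (t := t - s) (x := x - y) (sub_ne_zero.2 (Ne.symm hst))
        have hc2 : Tendsto (fun p : ℝ × ℝ => (p.1 - s, p.2 - y)) (𝓝 (t, x)) (𝓝 (t - s, x - y)) := by
          have : Continuous (fun p : ℝ × ℝ => (p.1 - s, p.2 - y)) := by fun_prop
          exact this.tendsto (t, x)
        have h3 := ((hc.tendsto.comp hc2).sub_const (greenGext β (t - s) (x - y))).pow 2
        simpa [Function.comp_def] using h3
    rw [hz2] at key
    exact key
end
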